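/- arXiv:2010.07383 — 6 statements merged into one kernel-verified Lean document; each statement's English description precedes it below -/
import Mathlib

section
/- Let S be a Polish space with its Borel σ-algebra, M > 0, X : S → [0,M] continuous, W₀ ∈ ℝ, Π₀ > 0, and u : ℝ → ℝ concave and continuous. Let 𝓚 be a nonempty convex compact (in the supremum norm, identified with a subset of C([0,M],ℝ) via Ŷ = Î∘X) set of indemnities contained in the no-sabotage class 𝓘̂, and let 𝓒 be a nonempty convex set of Borel probability measures on S that is compact in the topology of weak convergence. Then there exists a saddle point (Ŷ*, P*) ∈ 𝓚 × 𝓒, i.e., sup_{Ŷ∈𝓚} inf_{P∈𝓒} ∫ u(W₀ − X + Ŷ − Π₀) dP = ∫ u(W₀ − X + Ŷ* − Π₀) dP* = min_{P∈𝓒} max_{Ŷ∈𝓚} ∫ u(W₀ − X + Ŷ − Π₀) dP. -/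
open MeasureTheory
open scoped NNReal

open scoped BoundedContinuousFunction

section SaddleValue

variable {E F : Type*} {A : Set E} {B : Set F} {f : E → F → ℝ} {a : E} {b : F}

/-- The value at a saddle point is the lower value of the game. -/
theorem IsSaddlePointOn.ciSup_ciInf_eq (h : IsSaddlePointOn A B f a b) (ha : a ∈ A) (hb : b ∈ B)
    (hbdd : ∀ y ∈ B, BddBelow (Set.range fun x : A ↦ f x y)) :
    ⨆ y : B, ⨅ x : A, f x y = f a b := by
  have : Nonempty A := ⟨⟨a, ha⟩⟩
  have : Nonempty B := ⟨⟨b, hb⟩⟩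
  have hle (y : B) : ⨅ x : A, f x y ≤ f a b :=
    (ciInf_le (hbdd y y.2) ⟨a, ha⟩).trans (h a ha y y.2)
  refine le_antisymm (ciSup_le hle) ?_
  calc f a b ≤ ⨅ x : A, f x b := le_ciInf fun x ↦ h x x.2 b hb
    _ ≤ ⨆ y : B, ⨅ x : A, f x y :=
      le_ciSup (f := fun y : B ↦ ⨅ x : A, f x y) ⟨f a b, Set.forall_mem_range.2 hle⟩ ⟨b, hb⟩

/-- The value at a saddle point is the upper value of the game. -/
theorem IsSaddlePointOn.ciInf_ciSup_eq (h : IsSaddlePointOn A B f a b) (ha : a ∈ A) (hb : b ∈ B)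
    (hbdd : ∀ x ∈ A, BddAbove (Set.range fun y : B ↦ f x y)) :
    ⨅ x : A, ⨆ y : B, f x y = f a b := by
  have : Nonempty A := ⟨⟨a, ha⟩⟩
  have : Nonempty B := ⟨⟨b, hb⟩⟩
  have hle (x : A) : f a b ≤ ⨆ y : B, f x y :=
    (h x x.2 b hb).trans (le_ciSup (hbdd x x.2) ⟨b, hb⟩)
  refine le_antisymm ?_ (le_ciInf hle)
  calc ⨅ x : A, ⨆ y : B, f x y ≤ ⨆ y : B, f a y :=
      ciInf_le (f := fun x : A ↦ ⨆ y : B, f x y) ⟨f a b, Set.forall_mem_range.2 hle⟩ ⟨a, ha⟩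
    _ ≤ f a b := ciSup_le fun y ↦ h a ha y y.2

end SaddleValue

/-- Integration against a fixed probability measure is continuous for the sup norm. -/
theorem BoundedContinuousFunction.continuous_integral {Ω : Type*} [TopologicalSpace Ω]
    [MeasurableSpace Ω] [OpensMeasurableSpace Ω] (μ : Measure Ω) [IsProbabilityMeasure μ] :
    Continuous fun g : Ω →ᵇ ℝ ↦ ∫ ω, g ω ∂μ := by
  refine (LipschitzWith.of_dist_le_mul (K := 1) fun g₁ g₂ ↦ ?_).continuous
  rw [Real.dist_eq, ← integral_sub (g₁.integrable μ) (g₂.integrable μ), dist_eq_norm]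
  simpa using (g₁ - g₂).norm_integral_le_norm μ

/-- Saddle points for expected payoffs: a compact convex set of probability measures against a
compact convex set of strategies with concave payoffs. -/
theorem exists_isSaddlePointOn_integral {Ω F : Type*} [TopologicalSpace Ω] [MeasurableSpace Ω]
    [OpensMeasurableSpace Ω] [TopologicalSpace F] [AddCommGroup F] [Module ℝ F]
    [IsTopologicalAddGroup F] [ContinuousSMul ℝ F]
    {C : Set (ProbabilityMeasure Ω)} (hCne : C.Nonempty) (hC : IsCompact C)
    (hCcv : ∀ P₁ ∈ C, ∀ P₂ ∈ C, ∀ a b : ℝ≥0, a + b = 1 →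
      ∃ P ∈ C, P.toMeasure = a • P₁.toMeasure + b • P₂.toMeasure)
    {K : Set F} (hKne : K.Nonempty) (hK : IsCompact K) (hKcv : Convex ℝ K)
    {G : F → Ω →ᵇ ℝ} (hG : Continuous G) (hGcv : ∀ ω, ConcaveOn ℝ K fun y ↦ G y ω) :
    ∃ P ∈ C, ∃ y ∈ K,
      IsSaddlePointOn C K (fun (P : ProbabilityMeasure Ω) y ↦ ∫ ω, G y ω ∂P.toMeasure) P y := by
  let Φ : ProbabilityMeasure Ω → (Ω →ᵇ ℝ) → ℝ := fun P g ↦ ∫ ω, g ω ∂P.toMeasure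
  have hΦ : Continuous Φ := continuous_pi fun g ↦
    ProbabilityMeasure.continuous_integral_boundedContinuousFunction g
  have hconv : Convex ℝ (Φ '' C) := by
    rintro _ ⟨P₁, h₁, rfl⟩ _ ⟨P₂, h₂, rfl⟩ a b ha hb hab
    lift a to ℝ≥0 using ha
    lift b to ℝ≥0 using hb
    obtain ⟨P, hP, hPeq⟩ := hCcv P₁ h₁ P₂ h₂ a b (by exact_mod_cast hab)
    refine ⟨P, hP, funext fun g ↦ ?_⟩
    simp only [Φ, hPeq, Pi.add_apply, Pi.smul_apply]
    rw [integral_add_measure ((g.integrable _).smul_measure_nnreal)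
      ((g.integrable _).smul_measure_nnreal), integral_smul_nnreal_measure,
      integral_smul_nnreal_measure]
    rfl
  obtain ⟨_, ⟨P, hP, rfl⟩, y, hy, h⟩ :=
    Sion.exists_isSaddlePointOn (X := Φ '' C) (Y := K) (f := fun e y ↦ e (G y))
      (hCne.image Φ) hconv (hC.image hΦ)
      (fun y _ ↦ (continuous_apply (G y)).lowerSemicontinuous.lowerSemicontinuousOn _)
      (fun y _ ↦ ((LinearMap.proj (R := ℝ) (φ := fun _ : Ω →ᵇ ℝ ↦ ℝ) (G y)).convexOn
        hconv).quasiconvexOn)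
      hKcv hKne hK
      (by
        rintro _ ⟨P, -, rfl⟩
        exact ((BoundedContinuousFunction.continuous_integral P.toMeasure).comp
          hG).upperSemicontinuous.upperSemicontinuousOn _)
      (by
        rintro _ ⟨P, -, rfl⟩
        refine ConcaveOn.quasiconcaveOn ⟨hKcv, fun y₁ h₁ y₂ h₂ a b ha hb hab ↦ ?_⟩
        simp only [Φ, smul_eq_mul]
        rw [← integral_const_mul, ← integral_const_mul,
          ← integral_add (((G y₁).integrable _).const_mul a) (((G y₂).integrable _).const_mul b)]
        exact integral_mono
          ((((G y₁).integrable _).const_mul a).add (((G y₂).integrable _).const_mul b))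
          ((G _).integrable _) fun ω ↦ (hGcv ω).2 h₁ h₂ ha hb hab)
  exact ⟨P, hP, y, hy, fun Q hQ z hz ↦ h (Φ Q) (Set.mem_image_of_mem Φ hQ) z hz⟩

/-- Sion minimax / saddle-point existence for the maxmin insurance problem: on a Polish
space `S`, with a continuous loss `X : S → [0,M]`, a concave continuous utility `u`, a
nonempty convex sup-norm-compact set `𝓚 ⊆ 𝓘̂` of no-sabotage indemnities (identified with
a subset of `C([0,M],ℝ)` via `Ys = Î ∘ X`), and a nonempty convex weakly compact set `𝓒`
of Borel probability measures, there is a saddle point `(Ys*, P*) ∈ 𝓚 × 𝓒` with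
`sup_{Ys∈𝓚} inf_{P∈𝓒} ∫ u(W₀ − X + Ys − π₀) dP = ∫ u(W₀ − X + Ys* − π₀) dP*
 = inf_{P∈𝓒} sup_{Ys∈𝓚} ∫ u(W₀ − X + Ys − π₀) dP`. -/
theorem saddle_point_exists {S : Type*} [TopologicalSpace S] [PolishSpace S]
    [MeasurableSpace S] [BorelSpace S]
    (M : ℝ) (hM : 0 < M)
    (X : S → ℝ) (hXc : Continuous X) (hX : ∀ s, X s ∈ Set.Icc (0:ℝ) M)
    (W₀ π₀ : ℝ) (hπ : 0 < π₀)
    (u : ℝ → ℝ) (hu : ConcaveOn ℝ Set.univ u) (huc : Continuous u)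
    (𝓚 : Set C(Set.Icc (0:ℝ) M, ℝ)) (h𝓚ne : 𝓚.Nonempty) (h𝓚cv : Convex ℝ 𝓚)
    (h𝓚cp : IsCompact 𝓚)
    (h𝓚sub : ∀ f ∈ 𝓚, f ⟨0, Set.left_mem_Icc.mpr hM.le⟩ = 0 ∧
      ∀ x₁ x₂ : Set.Icc (0:ℝ) M, (x₂ : ℝ) ≤ (x₁ : ℝ) →
        0 ≤ f x₁ - f x₂ ∧ f x₁ - f x₂ ≤ (x₁ : ℝ) - (x₂ : ℝ))
    (𝓒 : Set (ProbabilityMeasure S)) (h𝓒ne : 𝓒.Nonempty) (h𝓒cp : IsCompact 𝓒)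
    (h𝓒cv : ∀ P₁ ∈ 𝓒, ∀ P₂ ∈ 𝓒, ∀ a b : ℝ≥0, a + b = 1 →
      ∃ P ∈ 𝓒, P.toMeasure = a • P₁.toMeasure + b • P₂.toMeasure) :
    ∃ Ys ∈ 𝓚, ∃ Pstar ∈ 𝓒,
      (⨆ f : 𝓚, ⨅ P : 𝓒,
          ∫ s, u (W₀ - X s + (f : C(Set.Icc (0:ℝ) M, ℝ)) ⟨X s, hX s⟩ - π₀)
            ∂(P : ProbabilityMeasure S).toMeasure)
        = ∫ s, u (W₀ - X s + Ys ⟨X s, hX s⟩ - π₀) ∂Pstar.toMeasure ∧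
      (∫ s, u (W₀ - X s + Ys ⟨X s, hX s⟩ - π₀) ∂Pstar.toMeasure)
        = ⨅ P : 𝓒, ⨆ f : 𝓚,
            ∫ s, u (W₀ - X s + (f : C(Set.Icc (0:ℝ) M, ℝ)) ⟨X s, hX s⟩ - π₀)
              ∂(P : ProbabilityMeasure S).toMeasure := by
  let ξ : C(S, Set.Icc (0:ℝ) M) := ⟨fun s ↦ ⟨X s, hX s⟩, hXc.subtype_mk hX⟩
  let w : C(Set.Icc (0:ℝ) M, ℝ) := ⟨fun x ↦ W₀ - x - π₀, by fun_prop⟩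
  let v : C(ℝ, ℝ) := ⟨u, huc⟩
  let G : C(Set.Icc (0:ℝ) M, ℝ) → S →ᵇ ℝ := fun y ↦
    (BoundedContinuousFunction.mkOfCompact (v.comp (w + y))).compContinuous ξ
  have hGval (y : C(Set.Icc (0:ℝ) M, ℝ)) (s : S) :
      G y s = u (W₀ - X s + y ⟨X s, hX s⟩ - π₀) :=
    congrArg u (show W₀ - X s - π₀ + y ⟨X s, hX s⟩ = _ by ring)
  have hG : Continuous G :=
    (BoundedContinuousFunction.continuous_compContinuous ξ).comp
      ((ContinuousMap.isometryEquivBoundedOfCompact _ _).continuous.comp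
        ((ContinuousMap.continuous_postcomp v).comp (continuous_const.add continuous_id)))
  have hGcv (s : S) : ConcaveOn ℝ 𝓚 fun y ↦ G y s := by
    refine ⟨h𝓚cv, fun y₁ _ y₂ _ a b ha hb hab ↦ ?_⟩
    simp only [hGval]
    refine (hu.2 (Set.mem_univ _) (Set.mem_univ _) ha hb hab).trans_eq (congrArg u ?_)
    simp only [smul_eq_mul, ContinuousMap.add_apply, ContinuousMap.smul_apply]
    linear_combination (W₀ - X s - π₀) * hab
  simp only [← hGval]
  obtain ⟨P, hP, y, hy, h⟩ :=
    exists_isSaddlePointOn_integral h𝓒ne h𝓒cp h𝓒cv h𝓚ne h𝓚cp h𝓚cv hG hGcv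
  refine ⟨y, hy, P, hP, h.ciSup_ciInf_eq hP hy fun z _ ↦ ?_,
    (h.ciInf_ciSup_eq hP hy fun Q _ ↦ ?_).symm⟩
  · simpa only [Set.image_eq_range] using h𝓒cp.bddBelow_image
      (ProbabilityMeasure.continuous_integral_boundedContinuousFunction (G z)).continuousOn
  · simpa only [Set.image_eq_range, Function.comp_def] using h𝓚cp.bddAbove_image
      ((BoundedContinuousFunction.continuous_integral Q.toMeasure).comp hG).continuousOn
end

section
/- Let (S,Σ) be a measurable space, M > 0, X : S → [0,M] measurable, Q and P probability measures on (S,Σ), with Lebesgue decomposition P = P_ac + P_s with respect to Q, A ∈ Σ such that Q(S∖A) = P_s(A) = 0, h = dP_ac/dQ, and A_h := {s ∈ A : h(s) = 0}. Suppose u : ℝ → ℝ is strictly increasing, strictly concave, continuously differentiable and satisfies u'(x) → +∞ as x → −∞ and u'(x) → 0 as x → +∞, and assume (1+ρ)E_Q[X] > Π₀ > 0. Then the problem of maximizing E_P[u(W₀ − X + Y − Π₀)] over Y ∈ 𝓘 subject to (1+ρ)E_Q[Y] ≤ Π₀ admits an optimal solution of the form Y* = (X − R*)·1_{A∖A_h}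 + (X − R_h)·1_{A_h} + X·1_{S∖A}, where: Case 1, if (1+ρ)E_Q[X·1_{S∖A_h}] > Π₀, then R* = max[0, min(X, W₀ − Π₀ − (u')⁻¹(λ*/h))] on A∖A_h and R_h = X·1_{A_h}, Q-a.s., for a multiplier λ* ≥ 0 such that (1+ρ)E_Q[Y*] = Π₀; Case 2, if (1+ρ)E_Q[X·1_{S∖A_h}] ≤ Π₀, then R* = 0 Q-a.s. and R_h = c·X·1_{A_h} with c := (E_Q[X] − (1+ρ)⁻¹Π₀)/E_Q[X·1_{A_h}] ∈ (0,1]. -/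
open MeasureTheory Filter Topology

/-- Marginal utility of a strictly increasing, strictly concave utility satisfying the Inada
conditions is strictly decreasing, positive, and inverted on the positive reals by
`y ↦ φ (-log y)` for an increasing homeomorphism `φ` of the line. -/
lemma exists_orderIso_neg_log_marginal {u u' : ℝ → ℝ}
    (hucc : StrictConcaveOn ℝ Set.univ u)
    (hud : ∀ x, HasDerivAt u (u' x) x) (hu'c : Continuous u')
    (hbot : Tendsto u' atBot atTop) (htop : Tendsto u' atTop (𝓝 0)) :
    StrictAnti u' ∧ ∃ φ : ℝ ≃o ℝ, ∀ x, u' (φ x) = Real.exp (-x) := by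
  have hanti : StrictAnti u' := by
    have key := hucc.strictAntiOn_deriv fun x _ => (hud x).differentiableAt
    have hderiv : deriv u = u' := funext fun x => (hud x).deriv
    rw [hderiv] at key
    exact fun x y hxy => key (Set.mem_univ x) (Set.mem_univ y) hxy
  have hpos : ∀ x, 0 < u' x := fun x =>
    (hanti.antitone.le_of_tendsto htop (x + 1)).trans_lt (hanti (lt_add_one x))
  have hmono : StrictMono fun x => -Real.log (u' x) := fun x y hxy =>
    neg_lt_neg (Real.log_lt_log (hpos y) (hanti hxy))
  have hcont : Continuous fun x => -Real.log (u' x) :=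
    (hu'c.log fun x => (hpos x).ne').neg
  have hsurj : Function.Surjective fun x => -Real.log (u' x) := by
    refine hcont.surjective ?_ ?_
    · refine tendsto_neg_atBot_atTop.comp (Real.tendsto_log_nhdsGT_zero.comp ?_)
      exact tendsto_nhdsWithin_iff.2 ⟨htop, Eventually.of_forall hpos⟩
    · exact tendsto_neg_atTop_atBot.comp (Real.tendsto_log_atTop.comp hbot)
  refine ⟨hanti, (hmono.orderIsoOfSurjective _ hsurj).symm, fun x => ?_⟩
  have key : -Real.log (u' ((hmono.orderIsoOfSurjective _ hsurj).symm x)) = x :=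
    (hmono.orderIsoOfSurjective _ hsurj).apply_symm_apply x
  rw [← Real.exp_log (hpos ((hmono.orderIsoOfSurjective _ hsurj).symm x))]
  congr 1
  linarith

lemma ConcaveOn.le_tangent {u : ℝ → ℝ} {d x : ℝ} (hu : ConcaveOn ℝ Set.univ u)
    (hd : HasDerivAt u d x) (y : ℝ) : u y ≤ u x + d * (y - x) := by
  rcases lt_trichotomy x y with hxy | rfl | hxy
  · have key := hu.slope_le_of_hasDerivAt (Set.mem_univ x) (Set.mem_univ y) hxy hd
    rw [slope_def_field, div_le_iff₀ (sub_pos.2 hxy)] at key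
    linarith
  · simp
  · have key := hu.le_slope_of_hasDerivAt (Set.mem_univ y) (Set.mem_univ x) hxy hd
    rw [slope_def_field, le_div_iff₀ (sub_pos.2 hxy)] at key
    linarith

/-- The clipped first-order condition maximizes the pointwise Lagrangian. -/
lemma lagrangian_le_of_clipped_foc {u u' : ℝ → ℝ} (hu : ConcaveOn ℝ Set.univ u)
    (hud : ∀ x, HasDerivAt u (u' x) x) (hanti : Antitone u') {g x y z η lam : ℝ}
    (hx : 0 ≤ x) (hy : 0 ≤ y) (hyx : y ≤ x) (hη : 0 ≤ η) (hz : η * u' z = lam) :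
    η * u (g - x + y) - lam * y ≤
      η * u (g - x + (x - max 0 (min x (g - z)))) - lam * (x - max 0 (min x (g - z))) := by
  set m := max 0 (min x (g - z)) with hm
  have tangent := mul_le_mul_of_nonneg_left (hu.le_tangent (hud (g - x + (x - m))) (g - x + y)) hη
  suffices hsign : (η * u' (g - x + (x - m)) - lam) * (y - (x - m)) ≤ 0 by nlinarith
  rcases le_total (g - z) 0 with h0 | h0
  · have hm0 : m = 0 := by rw [hm, max_eq_left (min_le_of_right_le h0)]
    rw [hm0]
    have : u' z ≤ u' (g - x + (x - 0)) := hanti (by linarith)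
    have := mul_le_mul_of_nonneg_left this hη
    exact mul_nonpos_of_nonneg_of_nonpos (by linarith) (by linarith)
  rcases le_total x (g - z) with h1 | h1
  · have hmx : m = x := by rw [hm, min_eq_left h1, max_eq_right hx]
    rw [hmx]
    have : u' (g - x + (x - x)) ≤ u' z := hanti (by linarith)
    have := mul_le_mul_of_nonneg_left this hη
    exact mul_nonpos_of_nonpos_of_nonneg (by linarith) (by linarith)
  · have hmz : m = g - z := by rw [hm, min_eq_right h1, max_eq_right h0]
    rw [hmz, show g - x + (x - (g - z)) = z by ring, hz]
    simp

/-- Weak duality: pointwise domination of the Lagrangian yields domination of the integrals. -/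
lemma integral_le_integral_of_lagrangian_le {S : Type*} [MeasurableSpace S] {Q Ps : Measure S}
    {h f g Y Z : S → ℝ} (hhm : Measurable h) (hh0 : ∀ s, 0 ≤ h s) {lam : ℝ}
    (hf : Integrable f (Q.withDensity (fun s => ENNReal.ofReal (h s)) + Ps))
    (hg : Integrable g (Q.withDensity (fun s => ENNReal.ofReal (h s)) + Ps))
    (hPs : f ≤ᵐ[Ps] g) (hY : Integrable Y Q) (hZ : Integrable Z Q)
    (hYZ : lam * ∫ s, Y s ∂Q ≤ lam * ∫ s, Z s ∂Q)
    (hQ : ∀ᵐ s ∂Q, h s * f s - lam * Y s ≤ h s * g s - lam * Z s) :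
    ∫ s, f s ∂(Q.withDensity (fun s => ENNReal.ofReal (h s)) + Ps) ≤
      ∫ s, g s ∂(Q.withDensity (fun s => ENNReal.ofReal (h s)) + Ps) := by
  have hlt : ∀ᵐ s ∂Q, ENNReal.ofReal (h s) < ⊤ := Eventually.of_forall fun _ => ENNReal.ofReal_lt_top
  have integrable_mul : ∀ k : S → ℝ, Integrable k (Q.withDensity fun s => ENNReal.ofReal (h s)) →
      Integrable (fun s => h s * k s) Q := fun k hk => by
    simpa [ENNReal.toReal_ofReal (hh0 _)] using
      (integrable_withDensity_iff_integrable_smul' hhm.ennreal_ofReal hlt).1 hk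
  have integral_mul : ∀ k : S → ℝ, ∫ s, k s ∂(Q.withDensity fun s => ENNReal.ofReal (h s)) =
      ∫ s, h s * k s ∂Q := fun k => by
    simp [integral_withDensity_eq_integral_toReal_smul hhm.ennreal_ofReal hlt,
      ENNReal.toReal_ofReal (hh0 _)]
  rw [integrable_add_measure] at hf hg
  rw [integral_add_measure hf.1 hf.2, integral_add_measure hg.1 hg.2, integral_mul, integral_mul]
  have hfQ := integrable_mul f hf.1
  have hgQ := integrable_mul g hg.1
  have key := integral_mono_ae (hfQ.sub (hY.const_mul lam)) (hgQ.sub (hZ.const_mul lam)) hQ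
  simp only [Pi.sub_apply] at key
  rw [integral_sub hfQ (hY.const_mul lam), integral_sub hgQ (hZ.const_mul lam),
    integral_const_mul, integral_const_mul] at key
  have := integral_mono_ae hf.2 hg.2 hPs
  linarith

lemma exists_integral_eq_of_dominated {S : Type*} [MeasurableSpace S] {Q : Measure S}
    [IsFiniteMeasure Q] {F : ℝ → S → ℝ} {Fbot Ftop : S → ℝ} {M c : ℝ}
    (hmeas : ∀ t, Measurable (F t)) (hbound : ∀ t s, |F t s| ≤ M)
    (hcont : ∀ s, Continuous fun t => F t s)
    (hbot : ∀ s, Tendsto (fun t => F t s) atBot (𝓝 (Fbot s)))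
    (htop : ∀ s, Tendsto (fun t => F t s) atTop (𝓝 (Ftop s)))
    (hc₁ : ∫ s, Ftop s ∂Q < c) (hc₂ : c < ∫ s, Fbot s ∂Q) :
    ∃ t, ∫ s, F t s ∂Q = c := by
  have cont : Continuous fun t => ∫ s, F t s ∂Q :=
    continuous_of_dominated (fun t => (hmeas t).aestronglyMeasurable)
      (fun t => Eventually.of_forall (hbound t)) (integrable_const M) (Eventually.of_forall hcont)
  have limit : ∀ (l : Filter ℝ) [l.IsCountablyGenerated] (G : S → ℝ),
      (∀ s, Tendsto (fun t => F t s) l (𝓝 (G s))) →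
      Tendsto (fun t => ∫ s, F t s ∂Q) l (𝓝 (∫ s, G s ∂Q)) := fun l _ G hG =>
    tendsto_integral_filter_of_dominated_convergence (fun _ => M)
      (Eventually.of_forall fun t => (hmeas t).aestronglyMeasurable)
      (Eventually.of_forall fun t => Eventually.of_forall (hbound t)) (integrable_const M)
      (Eventually.of_forall hG)
  obtain ⟨a, ha⟩ := ((limit atTop Ftop htop).eventually_lt_const hc₁).exists
  obtain ⟨b, hb⟩ := ((limit atBot Fbot hbot).eventually_const_lt hc₂).exists
  exact mem_range_of_exists_le_of_exists_ge cont ⟨a, ha.le⟩ ⟨b, hb.le⟩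

open Classical in
lemma indicator_split_eq_ite {S : Type*} (A : Set S) (h X R Rh : S → ℝ) (s : S) :
    (A \ {t | t ∈ A ∧ h t = 0}).indicator (fun t => X t - R t) s
        + ({t | t ∈ A ∧ h t = 0}).indicator (fun t => X t - Rh t) s
        + Aᶜ.indicator X s =
      if s ∈ A then (if h s = 0 then X s - Rh s else X s - R s) else X s := by
  by_cases hA : s ∈ A <;> by_cases h0 : h s = 0 <;> simp [hA, h0]

lemma measurable_indicator_split {S : Type*} [MeasurableSpace S] {A : Set S} {h X R Rh : S → ℝ}
    (hA : MeasurableSet A) (hh : Measurable h) (hX : Measurable X) (hR : Measurable R)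
    (hRh : Measurable Rh) :
    Measurable fun s => (A \ {t | t ∈ A ∧ h t = 0}).indicator (fun t => X t - R t) s
      + ({t | t ∈ A ∧ h t = 0}).indicator (fun t => X t - Rh t) s + Aᶜ.indicator X s := by
  have hAh : MeasurableSet {t | t ∈ A ∧ h t = 0} := hA.inter (hh (measurableSet_singleton 0))
  exact (((hX.sub hR).indicator (hA.diff hAh)).add ((hX.sub hRh).indicator hAh)).add
    (hX.indicator hA.compl)

lemma indicator_split_mem_Icc {S : Type*} {A : Set S} {h X R Rh : S → ℝ}
    (hX : ∀ s, 0 ≤ X s) (hR : ∀ s, R s ∈ Set.Icc 0 (X s))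
    (hRh : ∀ s ∈ A, h s = 0 → Rh s ∈ Set.Icc 0 (X s)) (s : S) :
    0 ≤ (A \ {t | t ∈ A ∧ h t = 0}).indicator (fun t => X t - R t) s
      + ({t | t ∈ A ∧ h t = 0}).indicator (fun t => X t - Rh t) s + Aᶜ.indicator X s ∧
    (A \ {t | t ∈ A ∧ h t = 0}).indicator (fun t => X t - R t) s
      + ({t | t ∈ A ∧ h t = 0}).indicator (fun t => X t - Rh t) s + Aᶜ.indicator X s ≤ X s := by
  rw [indicator_split_eq_ite]
  have hXs := hX s
  split_ifs with hA h0
  · obtain ⟨h1, h2⟩ := hRh s hA h0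
    constructor <;> linarith
  · obtain ⟨h1, h2⟩ := hR s
    constructor <;> linarith
  · exact ⟨hXs, le_rfl⟩

/-- Proposition 4.1 (risk-neutral insurer, no no-sabotage condition, fixed worst-case
prior): with `P = P_ac + P_s` the Lebesgue decomposition of `P` w.r.t. `Q`, `A` carrying
`Q` with `P_s(A) = 0`, `h = dP_ac/dQ`, `A_h = {h = 0} ∩ A`, `u` strictly increasing,
strictly concave, `C¹`, satisfying Inada conditions, and `(1+ρ)E_Q[X] > π₀ > 0`, the
problem of maximizing `E_P[u(W₀−X+Y−π₀)]` over `Y ∈ 𝓘` subject to `(1+ρ)E_Q[Y] ≤ π₀`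
admits an optimal solution `Y* = (X−R*)·1_{A∖A_h} + (X−R_h)·1_{A_h} + X·1_{S∖A}` with:
Case 1 — if `(1+ρ)E_Q[X·1_{S∖A_h}] > π₀`, then `Q`-a.s.
`R* = max(0, min(X, W₀−π₀−(u')⁻¹(λ*/h)))` on `A∖A_h` and `R_h = X` on `A_h`, for a
multiplier `λ* ≥ 0` making the budget constraint bind; Case 2 — if
`(1+ρ)E_Q[X·1_{S∖A_h}] ≤ π₀`, then `R* = 0` `Q`-a.s. and `R_h = c·X·1_{A_h}` with
`c = (E_Q[X] − (1+ρ)⁻¹π₀)/E_Q[X·1_{A_h}] ∈ (0,1]`. -/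
theorem optimal_indemnity_risk_neutral_insurer {S : Type*} [MeasurableSpace S]
    (M : ℝ) (hM : 0 < M)
    (X : S → ℝ) (hXm : Measurable X) (hX : ∀ s, X s ∈ Set.Icc (0:ℝ) M)
    (Q P Pac Ps : Measure S) [IsProbabilityMeasure Q] [IsProbabilityMeasure P]
    (hdec : P = Pac + Ps) (hac : Pac ≪ Q)
    (A : Set S) (hAm : MeasurableSet A) (hQA : Q Aᶜ = 0) (hPsA : Ps A = 0)
    (h : S → ℝ) (hhm : Measurable h) (hh0 : ∀ s, 0 ≤ h s)
    (hhd : Pac = Q.withDensity fun s => ENNReal.ofReal (h s))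
    (W₀ π₀ ρ : ℝ) (hπ : 0 < π₀) (hρ : 0 ≤ ρ)
    (hbudget : π₀ < (1 + ρ) * ∫ s, X s ∂Q)
    (u u' : ℝ → ℝ)
    (hu : StrictMono u) (hucc : StrictConcaveOn ℝ Set.univ u)
    (hud : ∀ x, HasDerivAt u (u' x) x) (hu'c : Continuous u')
    (huI₁ : Filter.Tendsto u' Filter.atBot Filter.atTop)
    (huI₂ : Filter.Tendsto u' Filter.atTop (nhds 0)) :
    ∃ (Ystar R Rh : S → ℝ),
      -- the form of the optimal indemnity
      Ystar = (fun s => (A \ {t | t ∈ A ∧ h t = 0}).indicator (fun t => X t - R t) s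
        + ({t | t ∈ A ∧ h t = 0}).indicator (fun t => X t - Rh t) s
        + Aᶜ.indicator X s) ∧
      -- feasibility of `Y*`
      Measurable Ystar ∧ (∀ s, 0 ≤ Ystar s ∧ Ystar s ≤ X s) ∧
      (1 + ρ) * (∫ s, Ystar s ∂Q) ≤ π₀ ∧
      -- optimality of `Y*` in `𝓘` subject to the budget constraint
      (∀ Y : S → ℝ, Measurable Y → (∀ s, 0 ≤ Y s ∧ Y s ≤ X s) →
        (1 + ρ) * (∫ s, Y s ∂Q) ≤ π₀ →
        (∫ s, u (W₀ - X s + Y s - π₀) ∂P) ≤ ∫ s, u (W₀ - X s + Ystar s - π₀) ∂P) ∧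
      -- Case 1
      (π₀ < (1 + ρ) * (∫ s in {t | t ∈ A ∧ h t = 0}ᶜ, X s ∂Q) →
        ∃ (lam : ℝ) (uInv : ℝ → ℝ), 0 ≤ lam ∧
          (∀ y : ℝ, 0 < y → u' (uInv y) = y) ∧
          (∀ᵐ s ∂Q, s ∈ A \ {t | t ∈ A ∧ h t = 0} →
            R s = max 0 (min (X s) (W₀ - π₀ - uInv (lam / h s)))) ∧
          (∀ᵐ s ∂Q, s ∈ {t | t ∈ A ∧ h t = 0} → Rh s = X s) ∧
          (1 + ρ) * (∫ s, Ystar s ∂Q) = π₀) ∧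
      -- Case 2
      ((1 + ρ) * (∫ s in {t | t ∈ A ∧ h t = 0}ᶜ, X s ∂Q) ≤ π₀ →
        (∀ᵐ s ∂Q, R s = 0) ∧
        ∃ c : ℝ,
          c = ((∫ s, X s ∂Q) - π₀ / (1 + ρ)) / (∫ s in {t | t ∈ A ∧ h t = 0}, X s ∂Q) ∧
          c ∈ Set.Ioc (0:ℝ) 1 ∧
          Rh = fun s => c * ({t | t ∈ A ∧ h t = 0}).indicator X s) := by
  subst hdec hhd
  have hρ' : 0 < 1 + ρ := by linarith
  have hXi : Integrable X Q := Integrable.of_mem_Icc 0 M hXm.aemeasurable (ae_of_all _ hX)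
  have hAh : MeasurableSet {t | t ∈ A ∧ h t = 0} := hAm.inter (hhm (measurableSet_singleton 0))
  have hQmem : ∀ᵐ s ∂Q, s ∈ A := measure_eq_zero_iff_ae_notMem.1 hQA |>.mono fun s hs => by
    simpa using hs
  have hPsmem : ∀ᵐ s ∂Ps, s ∉ A := measure_eq_zero_iff_ae_notMem.1 hPsA
  have feasible_integrable : ∀ Y : S → ℝ, Measurable Y → (∀ s, 0 ≤ Y s ∧ Y s ≤ X s) →
      Integrable Y Q := fun Y hYm hY =>
    Integrable.of_mem_Icc 0 M hYm.aemeasurable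
      (ae_of_all _ fun s => ⟨(hY s).1, (hY s).2.trans (hX s).2⟩)
  have utility_integrable : ∀ Y : S → ℝ, Measurable Y → (∀ s, 0 ≤ Y s ∧ Y s ≤ X s) →
      Integrable (fun s => u (W₀ - X s + Y s - π₀))
        (Q.withDensity (fun s => ENNReal.ofReal (h s)) + Ps) := fun Y hYm hY => by
    refine Integrable.of_mem_Icc (u (W₀ - M - π₀)) (u (W₀ - π₀))
      (hu.monotone.measurable.comp (((measurable_const.sub hXm).add hYm).sub_const π₀)).aemeasurable
      (ae_of_all _ fun s => ⟨hu.monotone ?_, hu.monotone ?_⟩)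
    · linarith [(hX s).2, (hY s).1]
    · linarith [(hY s).2]
  have optimal : ∀ (lam : ℝ) (Z : S → ℝ), 0 ≤ lam → Measurable Z → (∀ s, 0 ≤ Z s ∧ Z s ≤ X s) →
      (∀ s ∉ A, Z s = X s) → (1 + ρ) * ∫ s, Z s ∂Q = π₀ →
      (∀ Y : S → ℝ, (∀ s, 0 ≤ Y s ∧ Y s ≤ X s) → ∀ s ∈ A,
        h s * u (W₀ - X s + Y s - π₀) - lam * Y s ≤ h s * u (W₀ - X s + Z s - π₀) - lam * Z s) →
      ∀ Y : S → ℝ, Measurable Y → (∀ s, 0 ≤ Y s ∧ Y s ≤ X s) →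
        (1 + ρ) * (∫ s, Y s ∂Q) ≤ π₀ →
        (∫ s, u (W₀ - X s + Y s - π₀) ∂(Q.withDensity (fun s => ENNReal.ofReal (h s)) + Ps)) ≤
          ∫ s, u (W₀ - X s + Z s - π₀) ∂(Q.withDensity (fun s => ENNReal.ofReal (h s)) + Ps) := by
    intro lam Z hlam hZm hZ hZA hZb hlag Y hYm hY hYb
    refine integral_le_integral_of_lagrangian_le hhm hh0 (lam := lam) (utility_integrable Y hYm hY)
      (utility_integrable Z hZm hZ) ?_ (feasible_integrable Y hYm hY)
      (feasible_integrable Z hZm hZ) ?_ (hQmem.mono (hlag Y hY))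
    · filter_upwards [hPsmem] with s hs
      refine hu.monotone ?_
      rw [hZA s hs]
      linarith [(hY s).2]
    · refine mul_le_mul_of_nonneg_left ?_ hlam
      exact le_of_mul_le_mul_left (hYb.trans hZb.ge) hρ'
  obtain ⟨hanti, φ, hφ⟩ := exists_orderIso_neg_log_marginal hucc hud hu'c huI₁ huI₂
  by_cases hcase : π₀ < (1 + ρ) * (∫ s in {t | t ∈ A ∧ h t = 0}ᶜ, X s ∂Q)
  · let R : ℝ → S → ℝ := fun t s =>
      max 0 (min (X s) (W₀ - π₀ - φ (Real.log (h s) - t)))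
    let F : ℝ → S → ℝ := fun t s =>
      (A \ {t | t ∈ A ∧ h t = 0}).indicator (fun r => X r - R t r) s
        + ({t | t ∈ A ∧ h t = 0}).indicator (fun r => X r - X r) s + Aᶜ.indicator X s
    have hRm : ∀ t, Measurable (R t) := fun t =>
      measurable_const.max (hXm.min (measurable_const.sub
        (φ.continuous.measurable.comp ((Real.measurable_log.comp hhm).sub_const t))))
    have hFm : ∀ t, Measurable (F t) := fun t =>
      measurable_indicator_split hAm hhm hXm (hRm t) hXm
    have hF : ∀ t s, 0 ≤ F t s ∧ F t s ≤ X s := fun t =>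
      indicator_split_mem_Icc (fun s => (hX s).1)
        (fun s => ⟨le_max_left _ _, max_le (hX s).1 (min_le_left _ _)⟩)
        (fun s _ _ => ⟨(hX s).1, le_rfl⟩)
    have hFcont : ∀ s, Continuous fun t => F t s := fun s => by
      by_cases hA : s ∈ A <;> by_cases h0 : h s = 0 <;>
        simp only [F, R, indicator_split_eq_ite, hA, h0, if_true, if_false]
      · exact continuous_const
      · exact continuous_const.sub (continuous_const.max (continuous_const.min
          (continuous_const.sub (φ.continuous.comp (continuous_const.sub continuous_id)))))
      · exact continuous_const
      · exact continuous_const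
    have hFbot : ∀ s, Tendsto (fun t => F t s) atBot
        (𝓝 (({t | t ∈ A ∧ h t = 0}ᶜ).indicator X s)) := fun s => by
      refine tendsto_const_nhds.congr' ?_
      have hlim : Tendsto (fun t => φ (Real.log (h s) - t)) atBot atTop :=
        φ.tendsto_atTop.comp (tendsto_const_nhds.add_atTop tendsto_neg_atBot_atTop)
      filter_upwards [hlim.eventually_ge_atTop (W₀ - π₀)] with t ht
      have hR0 : R t s = 0 := max_eq_left (min_le_of_right_le (by linarith))
      simp only [F, indicator_split_eq_ite, hR0]
      by_cases hA : s ∈ A <;> by_cases h0 : h s = 0 <;> simp [hA, h0]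
    have hFtop : ∀ s, Tendsto (fun t => F t s) atTop (𝓝 (Aᶜ.indicator X s)) := fun s => by
      refine tendsto_const_nhds.congr' ?_
      have hlim : Tendsto (fun t => φ (Real.log (h s) - t)) atTop atBot :=
        φ.tendsto_atBot.comp (tendsto_const_nhds.add_atBot tendsto_neg_atTop_atBot)
      filter_upwards [hlim.eventually_le_atBot (W₀ - π₀ - X s)] with t ht
      have hRX : R t s = X s := by
        simp only [R]
        rw [min_eq_left (by linarith), max_eq_right (hX s).1]
      simp only [F, indicator_split_eq_ite, hRX]
      by_cases hA : s ∈ A <;> by_cases h0 : h s = 0 <;> simp [hA]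
    obtain ⟨t, ht⟩ : ∃ t, ∫ s, F t s ∂Q = π₀ / (1 + ρ) := by
      refine exists_integral_eq_of_dominated (M := M) hFm
        (fun t s => abs_le.2 ⟨by linarith [(hF t s).1], (hF t s).2.trans (hX s).2⟩)
        hFcont hFbot hFtop ?_ ?_
      · rw [integral_indicator hAm.compl, setIntegral_measure_zero _ hQA]
        positivity
      · rw [integral_indicator hAh.compl, div_lt_iff₀' hρ']
        exact hcase
    have hbind : (1 + ρ) * ∫ s, F t s ∂Q = π₀ := by
      rw [ht]
      field_simp
    refine ⟨F t, R t, X, rfl, hFm t, hF t, hbind.le,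
      optimal (Real.exp t) (F t) (Real.exp_pos t).le (hFm t) (hF t) (fun s hs => ?_) hbind ?_,
      fun _ => ⟨Real.exp t, fun y => φ (-Real.log y), (Real.exp_pos t).le, fun y hy => ?_,
        ae_of_all _ fun s hs => ?_, ae_of_all _ fun _ _ => rfl, hbind⟩,
      fun hle => absurd hle hcase.not_ge⟩
    · simp only [F, indicator_split_eq_ite, hs, if_false]
    · intro Y hY s hs
      simp only [F, indicator_split_eq_ite, hs, if_true]
      by_cases h0 : h s = 0
      · have := mul_nonneg (Real.exp_pos t).le (hY s).1
        simp only [h0, if_true]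
        linarith
      · have hpos : 0 < h s := (hh0 s).lt_of_ne' h0
        have hfoc : h s * u' (φ (Real.log (h s) - t)) = Real.exp t := by
          rw [hφ, neg_sub, Real.exp_sub, Real.exp_log hpos]
          field_simp
        have key := lagrangian_le_of_clipped_foc (g := W₀ - π₀) hucc.concaveOn hud hanti.antitone
          (hX s).1 (hY s).1 (hY s).2 hpos.le hfoc
        simp only [h0, if_false, R]
        rw [show W₀ - X s + Y s - π₀ = W₀ - π₀ - X s + Y s by ring, add_sub_right_comm,
          show W₀ - X s - π₀ = W₀ - π₀ - X s by ring]
        exact key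
    · rw [hφ, neg_neg, Real.exp_log hy]
    · have h0 : h s ≠ 0 := fun h0 => hs.2 ⟨hs.1, h0⟩
      simp only [R]
      rw [Real.log_div (Real.exp_pos t).ne' h0, Real.log_exp, neg_sub]
  · have hle := not_lt.1 hcase
    have hsplit := integral_add_compl hAh hXi
    set D := ∫ s in {t | t ∈ A ∧ h t = 0}, X s ∂Q with hD
    have hgap : 0 < (∫ s, X s ∂Q) - π₀ / (1 + ρ) := by
      rw [sub_pos, div_lt_iff₀' hρ']
      exact hbudget
    have hgap_le : (∫ s, X s ∂Q) - π₀ / (1 + ρ) ≤ D := by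
      have := (le_div_iff₀' hρ').2 hle
      linarith
    have hDpos : 0 < D := hgap.trans_le hgap_le
    set c := ((∫ s, X s ∂Q) - π₀ / (1 + ρ)) / D with hc
    have hc0 : 0 < c := div_pos hgap hDpos
    have hc1 : c ≤ 1 := (div_le_one hDpos).2 hgap_le
    let Rh : S → ℝ := fun s => c * ({t | t ∈ A ∧ h t = 0}).indicator X s
    let Z : S → ℝ := fun s => (A \ {t | t ∈ A ∧ h t = 0}).indicator (fun t => X t - 0) s
        + ({t | t ∈ A ∧ h t = 0}).indicator (fun t => X t - Rh t) s + Aᶜ.indicator X s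
    have hZm : Measurable Z :=
      measurable_indicator_split hAm hhm hXm measurable_const ((hXm.indicator hAh).const_mul c)
    have hZ : ∀ s, 0 ≤ Z s ∧ Z s ≤ X s := by
      refine indicator_split_mem_Icc (fun s => (hX s).1) (fun s => ⟨le_rfl, (hX s).1⟩)
        (fun s hA h0 => ?_)
      have hs : s ∈ {t | t ∈ A ∧ h t = 0} := ⟨hA, h0⟩
      simp only [Rh, Set.indicator_of_mem hs]
      exact ⟨mul_nonneg hc0.le (hX s).1, mul_le_of_le_one_left (hX s).1 hc1⟩
    have hZeq : ∀ s, Z s = X s - Rh s := fun s => by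
      simp only [Z, Rh, indicator_split_eq_ite]
      by_cases hA : s ∈ A <;> by_cases h0 : h s = 0 <;> simp [hA, h0]
    have hbind : (1 + ρ) * ∫ s, Z s ∂Q = π₀ := by
      simp only [hZeq, Rh]
      rw [integral_sub hXi ((hXi.indicator hAh).const_mul c), integral_const_mul,
        integral_indicator hAh, ← hD, hc, div_mul_cancel₀ _ hDpos.ne']
      field_simp
      ring
    refine ⟨Z, fun _ => 0, Rh, rfl, hZm, hZ, hbind.le,
      optimal 0 Z le_rfl hZm hZ (fun s hs => ?_) hbind ?_, fun hlt => absurd hlt hcase,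
      fun _ => ⟨ae_of_all _ fun _ => rfl, c, rfl, ⟨hc0, hc1⟩, rfl⟩⟩
    · simp only [Z, indicator_split_eq_ite, hs, if_false]
    · intro Y hY s hs
      rw [zero_mul, zero_mul, sub_zero, sub_zero]
      by_cases h0 : h s = 0
      · simp [h0]
      · refine mul_le_mul_of_nonneg_left (hu.monotone ?_) (hh0 s)
        simp only [Z, indicator_split_eq_ite, hs, h0, if_true, if_false]
        linarith [(hY s).2]
end

section
/- Let (S,Σ) be a measurable space, M > 0, X : S → [0,M] measurable, Q and P probability measures on (S,Σ), with Lebesgue decomposition P = P_ac + P_s with respect to Q, A ∈ Σ such that Q(S∖A) = P_s(A) = 0, h = dP_ac/dQ, and ξ : ℝ₊ → ℝ₊ Borel measurable with h = ξ∘X. Suppose u : ℝ → ℝ is strictly increasing, concave and continuously differentiable, and assume (1+ρ)E_Q[X] > Π₀ > 0. Then the problem of maximizing E_P[u(W₀ − X + Ŷ − Π₀)] over Ŷ ∈ 𝓘̂ subject to (1+ρ)E_Q[Ŷ] ≤ Π₀ admits an optimal solution of the form Ŷ* = (X − R̂*)·1_A + X·1_{S∖A} (belonging to 𝓘̂ Q-a.s.),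 where R̂* = r̂*∘X with r̂*(x) = ∫₀ˣ (r̂*)'(t) dt for all x ∈ [0,M], and there exist a multiplier λ* ≥ 0 with (1+ρ)E_Q[Ŷ*] = Π₀ and a Lebesgue-measurable [0,1]-valued function κ such that (r̂*)'(t) equals 0, κ(t), or 1 according as the integral ∫_{[t,M]∩X(A)} [u'(W₀ − r̂*(x) − Π₀)·ξ(x) − λ*] d(Q∘X⁻¹)(x) is positive, zero, or negative. -/
open MeasureTheory

/-- A function `Y : S → ℝ` is a no-sabotage indemnity for the loss `X : S → [0,M]`:
`Y = Î ∘ X` with `Î 0 = 0` and `0 ≤ Î x₁ − Î x₂ ≤ x₁ − x₂` for `0 ≤ x₂ ≤ x₁ ≤ M`. -/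
def NoSabotage {S : Type*} (M : ℝ) (X : S → ℝ) (Y : S → ℝ) : Prop :=
  ∃ I : ℝ → ℝ, I 0 = 0 ∧
    (∀ x₁ x₂ : ℝ, 0 ≤ x₂ → x₂ ≤ x₁ → x₁ ≤ M → 0 ≤ I x₁ - I x₂ ∧ I x₁ - I x₂ ≤ x₁ - x₂) ∧
    ∀ s, Y s = I (X s)

/-- A retention schedule: a nondecreasing function with slope at most one, vanishing at `0`. -/
def IsRetention (r : ℝ → ℝ) : Prop :=
  r 0 = 0 ∧ Monotone r ∧ LipschitzWith 1 r

namespace IsRetention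

variable {r q : ℝ → ℝ} {M x : ℝ}

theorem zero : IsRetention fun _ => 0 :=
  ⟨rfl, monotone_const, LipschitzWith.const' 0⟩

theorem sub_le (hr : IsRetention r) {y z : ℝ} (h : y ≤ z) : r z - r y ≤ z - y := by
  have h1 := hr.2.2.dist_le_mul z y
  rw [Real.dist_eq, Real.dist_eq, abs_of_nonneg (sub_nonneg.2 h), NNReal.coe_one, one_mul] at h1
  exact (le_abs_self _).trans h1

theorem of_monotone_of_sub_le (h0 : r 0 = 0) (hm : Monotone r)
    (hs : ∀ y z, y ≤ z → r z - r y ≤ z - y) : IsRetention r := by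
  refine ⟨h0, hm, LipschitzWith.of_dist_le_mul fun y z => ?_⟩
  rw [NNReal.coe_one, one_mul, Real.dist_eq, Real.dist_eq]
  rcases le_total y z with h | h
  · rw [abs_sub_comm, abs_sub_comm y, abs_of_nonneg (sub_nonneg.2 (hm h)),
      abs_of_nonneg (sub_nonneg.2 h)]
    exact hs y z h
  · rw [abs_of_nonneg (sub_nonneg.2 (hm h)), abs_of_nonneg (sub_nonneg.2 h)]
    exact hs z y h

theorem continuous (hr : IsRetention r) : Continuous r := hr.2.2.continuous

theorem mem_Icc (hr : IsRetention r) (hx : x ∈ Set.Icc 0 M) : r x ∈ Set.Icc 0 M := by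
  have h1 := hr.2.1 hx.1
  have h2 := hr.sub_le hx.1
  rw [hr.1] at h1 h2
  exact ⟨h1, by linarith [hx.2]⟩

theorem const_mul_id {a : ℝ} (ha : a ∈ Set.Icc (0 : ℝ) 1) : IsRetention fun x => a * x := by
  refine of_monotone_of_sub_le (mul_zero a) (monotone_id.const_mul ha.1) fun y z h => ?_
  nlinarith [ha.2]

theorem convex_comb (hr : IsRetention r) (hq : IsRetention q) {a b : ℝ} (ha : 0 ≤ a)
    (hb : 0 ≤ b) (hab : a + b = 1) : IsRetention fun x => a * r x + b * q x := by
  refine of_monotone_of_sub_le (by simp [hr.1, hq.1]) (fun y z h => ?_) fun y z h => ?_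
  · exact add_le_add (mul_le_mul_of_nonneg_left (hr.2.1 h) ha)
      (mul_le_mul_of_nonneg_left (hq.2.1 h) hb)
  · have h1 := mul_le_mul_of_nonneg_left (hr.sub_le h) ha
    have h2 := mul_le_mul_of_nonneg_left (hq.sub_le h) hb
    have h3 : a * (z - y) + b * (z - y) = z - y := by rw [← add_mul, hab, one_mul]
    linarith

theorem deriv_mem_Icc (hr : IsRetention r) : deriv r x ∈ Set.Icc (0 : ℝ) 1 := by
  refine ⟨hr.2.1.deriv_nonneg, (le_abs_self _).trans ?_⟩
  simpa using norm_deriv_le_of_lipschitz (x₀ := x) hr.2.2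

theorem integral_deriv (hr : IsRetention r) (x : ℝ) : ∫ t in (0 : ℝ)..x, deriv r t = r x := by
  have h := (hr.2.2.lipschitzOnWith (s := Set.uIcc 0 x)).absolutelyContinuousOnInterval
  rw [h.integral_deriv_eq_sub, hr.1, sub_zero]

theorem intervalIntegral_of_mem_Icc {g : ℝ → ℝ} (hg : Measurable g)
    (hg01 : ∀ t, g t ∈ Set.Icc (0 : ℝ) 1) : IsRetention fun x => ∫ t in (0 : ℝ)..x, g t := by
  have hint : ∀ a b, IntervalIntegrable g volume a b := fun a b =>
    (intervalIntegrable_const (c := (1 : ℝ))).mono_fun hg.aestronglyMeasurable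
      (Filter.Eventually.of_forall fun t => by
        simpa [abs_of_nonneg (hg01 t).1] using (hg01 t).2)
  have hsub : ∀ y z, (∫ t in (0 : ℝ)..z, g t) - ∫ t in (0 : ℝ)..y, g t = ∫ t in y..z, g t :=
    fun y z => intervalIntegral.integral_interval_sub_left (hint _ _) (hint _ _)
  refine of_monotone_of_sub_le (by simp) (fun y z h => ?_) fun y z h => ?_
  · rw [← sub_nonneg, hsub]
    exact intervalIntegral.integral_nonneg h fun t _ => (hg01 t).1
  · rw [hsub]
    have := intervalIntegral.integral_mono_on (g := fun _ => (1 : ℝ)) h (hint y z)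
      intervalIntegrable_const fun t _ => (hg01 t).2
    simpa using this

/-- The retention left by a no-sabotage indemnity schedule, extended constantly outside
`[0, M]`. -/
theorem of_indemnity (hM : 0 ≤ M) {I : ℝ → ℝ} (h0 : I 0 = 0)
    (hI : ∀ x₁ x₂ : ℝ, 0 ≤ x₂ → x₂ ≤ x₁ → x₁ ≤ M →
      0 ≤ I x₁ - I x₂ ∧ I x₁ - I x₂ ≤ x₁ - x₂) :
    IsRetention fun x => max 0 (min x M) - I (max 0 (min x M)) := by
  have hmono : ∀ y z : ℝ, y ≤ z → max 0 (min y M) ≤ max 0 (min z M) := fun y z h =>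
    max_le_max le_rfl (min_le_min h le_rfl)
  have hle : ∀ y : ℝ, max 0 (min y M) ≤ M := fun y => max_le hM (min_le_right _ _)
  have hI' := fun y z h => hI _ _ (le_max_left 0 (min y M)) (hmono y z h) (hle z)
  refine of_monotone_of_sub_le ?_ (fun y z h => ?_) fun y z h => ?_
  · simp [hM, h0]
  · have := (hI' y z h).2
    linarith
  · have h1 := (hI' y z h).1
    have h2 : max 0 (min z M) - max 0 (min y M) ≤ z - y := by
      rcases le_total z M with h3 | h3 <;> rcases le_total y M with h4 | h4 <;>
      simp only [min_eq_left, min_eq_right, h3, h4] <;>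
      rcases max_cases 0 z with h5 | h5 <;> rcases max_cases 0 y with h6 | h6 <;>
      rcases max_cases 0 M with h7 | h7 <;> linarith
    linarith

end IsRetention

section Existence

variable {M : ℝ}

theorem isCompact_setOf_monotone_lipschitz (hM : 0 ≤ M) :
    IsCompact {f : BoundedContinuousFunction (Set.Icc (0 : ℝ) M) ℝ |
      f ⟨0, le_rfl, hM⟩ = 0 ∧ Monotone f ∧ LipschitzWith 1 f} := by
  refine BoundedContinuousFunction.arzela_ascoli₂ (Set.Icc 0 M) isCompact_Icc _ ?_ ?_ ?_
  · simp only [Monotone, lipschitzWith_iff_dist_le_mul, Set.ofPred_and, Set.ofPred_forall]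
    have hc : ∀ x : Set.Icc (0 : ℝ) M, Continuous
        fun f : BoundedContinuousFunction (Set.Icc (0 : ℝ) M) ℝ => f x :=
      fun x => continuous_eval_const x
    refine (isClosed_eq (hc _) continuous_const).inter (IsClosed.inter ?_ ?_)
    · exact isClosed_iInter fun x => isClosed_iInter fun y => isClosed_iInter fun _ =>
        isClosed_le (hc x) (hc y)
    · exact isClosed_iInter fun x => isClosed_iInter fun y =>
        isClosed_le ((hc x).dist (hc y)) continuous_const
  · rintro f x ⟨h0, hm, hl⟩
    have h1 := hm (show (⟨0, le_rfl, hM⟩ : Set.Icc (0 : ℝ) M) ≤ x from x.2.1)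
    have h2 := hl.dist_le_mul x ⟨0, le_rfl, hM⟩
    rw [h0] at h1 h2
    rw [Subtype.dist_eq, Real.dist_eq, Real.dist_eq, NNReal.coe_one, one_mul, sub_zero,
      sub_zero, abs_of_nonneg h1, abs_of_nonneg x.2.1] at h2
    exact ⟨h1, h2.trans x.2.2⟩
  · exact (LipschitzWith.uniformEquicontinuous _ 1 fun f => f.2.2.2).equicontinuous

theorem Continuous.exists_norm_le_on_Icc {v : ℝ → ℝ} (hv : Continuous v) (M : ℝ) :
    ∃ C, ∀ y ∈ Set.Icc 0 M, ‖v y‖ ≤ C :=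
  isCompact_Icc.exists_bound_of_continuousOn hv.continuousOn

theorem integrable_comp_of_mem_Icc {α : Type*} [MeasurableSpace α] {μ : Measure α}
    [IsFiniteMeasure μ] {v : ℝ → ℝ} (hv : Continuous v) {f : α → ℝ} (hf : Measurable f)
    (hfM : ∀ᵐ x ∂μ, f x ∈ Set.Icc 0 M) : Integrable (fun x => v (f x)) μ := by
  obtain ⟨C, hC⟩ := Continuous.exists_norm_le_on_Icc hv M
  refine Integrable.of_bound (hv.measurable.comp hf).aestronglyMeasurable C ?_
  filter_upwards [hfM] with x hx using hC _ hx

theorem exists_retention_isMax (hM : 0 ≤ M) (μ ν : Measure ℝ) [IsFiniteMeasure μ]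
    [IsFiniteMeasure ν] (hμ : ∀ᵐ x ∂μ, x ∈ Set.Icc 0 M) (hν : ∀ᵐ x ∂ν, x ∈ Set.Icc 0 M)
    {v : ℝ → ℝ} (hv : Continuous v) {c : ℝ}
    (hne : ∃ q, IsRetention q ∧ ∫ x, q x ∂μ = c) :
    ∃ r, IsRetention r ∧ ∫ x, r x ∂μ = c ∧
      ∀ q, IsRetention q → ∫ x, q x ∂μ = c → ∫ x, v (q x) ∂ν ≤ ∫ x, v (r x) ∂ν := by
  set K := {f : BoundedContinuousFunction (Set.Icc (0 : ℝ) M) ℝ |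
      f ⟨0, le_rfl, hM⟩ = 0 ∧ Monotone f ∧ LipschitzWith 1 f} with hK
  have hKc : IsCompact K := isCompact_setOf_monotone_lipschitz hM
  let E : BoundedContinuousFunction (Set.Icc (0 : ℝ) M) ℝ → ℝ → ℝ :=
    fun f x => f (Set.projIcc 0 M hM x)
  have hE : ∀ f ∈ K, IsRetention (E f) := by
    rintro f ⟨h0, hm, hl⟩
    refine ⟨?_, hm.comp (Set.monotone_projIcc hM), ?_⟩
    · simpa [E] using h0
    · have := hl.comp (LipschitzWith.projIcc hM)
      rwa [one_mul] at this
  have hcont : ∀ (w : ℝ → ℝ) (m : Measure ℝ) [IsFiniteMeasure m], Continuous w →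
      (∀ᵐ x ∂m, x ∈ Set.Icc 0 M) → ContinuousOn (fun f => ∫ x, w (E f x) ∂m) K := by
    intro w m _ hw hm
    obtain ⟨C, hC⟩ := Continuous.exists_norm_le_on_Icc hw M
    refine continuousOn_of_dominated (bound := fun _ => C) (fun f hf => ?_) (fun f hf => ?_)
      (integrable_const C) ?_
    · exact (hw.comp (hE f hf).continuous).aestronglyMeasurable
    · filter_upwards [hm] with x hx using hC _ ((hE f hf).mem_Icc hx)
    · exact Filter.Eventually.of_forall fun x =>
        (hw.comp (continuous_eval_const _)).continuousOn
  have hres : ∀ q, IsRetention q → ∃ f ∈ K, ∀ x ∈ Set.Icc 0 M, E f x = q x := by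
    intro q hq
    refine ⟨BoundedContinuousFunction.mkOfCompact ⟨fun x => q x.1,
      hq.continuous.comp continuous_subtype_val⟩, ⟨hq.1, fun x y h => hq.2.1 h, ?_⟩, ?_⟩
    · have := hq.2.2.comp (LipschitzWith.subtype_val (Set.Icc 0 M))
      rwa [one_mul] at this
    · intro x hx
      simp [E, Set.projIcc_of_mem hM hx]
  have hint : ∀ (w : ℝ → ℝ) (m : Measure ℝ) (f : BoundedContinuousFunction _ ℝ) (q : ℝ → ℝ),
      (∀ᵐ x ∂m, x ∈ Set.Icc 0 M) → (∀ x ∈ Set.Icc 0 M, E f x = q x) →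
      ∫ x, w (E f x) ∂m = ∫ x, w (q x) ∂m := by
    intro w m f q hm hfq
    refine integral_congr_ae ?_
    filter_upwards [hm] with x hx
    rw [hfq x hx]
  have hGc := hcont id μ continuous_id hμ
  have hSc : IsCompact (K ∩ (fun f => ∫ x, id (E f x) ∂μ) ⁻¹' {c}) :=
    hKc.of_isClosed_subset
      (hGc.preimage_isClosed_of_isClosed hKc.isClosed isClosed_singleton)
      Set.inter_subset_left
  obtain ⟨q, hq, hqc⟩ := hne
  obtain ⟨f, hfK, hfq⟩ := hres q hq
  obtain ⟨f₀, hf₀, hmax⟩ := hSc.exists_isMaxOn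
    ⟨f, hfK, (hint id μ f q hμ hfq).trans hqc⟩
    ((hcont v ν hv hν).mono Set.inter_subset_left)
  refine ⟨E f₀, hE f₀ hf₀.1, hf₀.2, fun p hp hpc => ?_⟩
  obtain ⟨k, hkK, hkp⟩ := hres p hp
  rw [← hint v ν k p hν hkp]
  exact hmax ⟨hkK, (hint id μ k p hμ hkp).trans hpc⟩

end Existence

section FirstOrder

theorem ConcaveOn.le_add_mul_sub_of_hasDerivAt {v : ℝ → ℝ} {v' b : ℝ}
    (hv : ConcaveOn ℝ Set.univ v) (hd : HasDerivAt v v' b) (a : ℝ) :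
    v a ≤ v b + v' * (a - b) := by
  rcases lt_trichotomy a b with h | rfl | h
  · have h1 := hv.le_slope_of_hasDerivAt (Set.mem_univ a) (Set.mem_univ b) h hd
    rw [slope_def_field, le_div_iff₀ (sub_pos.2 h)] at h1
    linarith
  · simp
  · have h1 := hv.slope_le_of_hasDerivAt (Set.mem_univ b) (Set.mem_univ a) h hd
    rw [slope_def_field, div_le_iff₀ (sub_pos.2 h)] at h1
    linarith

theorem Convex.exists_multiplier {C : Set (ℝ × ℝ)} (hC : Convex ℝ C)
    (h0 : ∀ y, ((0 : ℝ), y) ∈ C → y ≤ 0) (hpos : ∃ p ∈ C, 0 < p.1) (hneg : ∃ p ∈ C, p.1 < 0) :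
    ∃ l : ℝ, ∀ p ∈ C, p.2 ≤ l * p.1 := by
  have key : ∀ p ∈ C, 0 < p.1 → ∀ q ∈ C, q.1 < 0 → p.2 / p.1 ≤ q.2 / q.1 := by
    intro p hp hp0 q hq hq0
    have hd : 0 < p.1 - q.1 := by linarith
    have hm := hC hp hq (a := -q.1 / (p.1 - q.1)) (b := p.1 / (p.1 - q.1))
      (div_nonneg (by linarith) hd.le) (div_nonneg hp0.le hd.le)
      (by rw [← add_div, div_eq_one_iff_eq hd.ne']; ring)
    have h1 := h0 ((-q.1 * p.2 + p.1 * q.2) / (p.1 - q.1)) (by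
      convert hm using 1
      ext
      · simp only [Prod.fst_add, Prod.smul_fst, smul_eq_mul]; field_simp; ring
      · simp only [Prod.snd_add, Prod.smul_snd, smul_eq_mul]; field_simp)
    rw [div_le_iff₀ hd, zero_mul] at h1
    rw [div_le_iff₀ hp0, div_mul_eq_mul_div, le_div_iff_of_neg hq0]
    linarith
  obtain ⟨p, hp, hp0⟩ := hpos
  obtain ⟨q, hq, hq0⟩ := hneg
  set T := {s : ℝ | ∃ p ∈ C, 0 < p.1 ∧ s = p.2 / p.1} with hT
  have hTne : T.Nonempty := ⟨_, p, hp, hp0, rfl⟩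
  have hTb : ∀ q ∈ C, q.1 < 0 → q.2 / q.1 ∈ upperBounds T := by
    rintro q hq hq0 _ ⟨p, hp, hp0, rfl⟩
    exact key p hp hp0 q hq hq0
  refine ⟨sSup T, fun k hk => ?_⟩
  rcases lt_trichotomy k.1 0 with h | h | h
  · have := csSup_le hTne (hTb k hk h)
    rwa [le_div_iff_of_neg h] at this
  · rw [h, mul_zero]
    exact h0 _ (by rwa [← h])
  · have : k.2 / k.1 ≤ sSup T := le_csSup ⟨_, hTb q hq hq0⟩ ⟨k, hk, h, rfl⟩
    rwa [div_le_iff₀ h] at this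

variable {M : ℝ}

theorem IsRetention.integrable {q : ℝ → ℝ} (hq : IsRetention q) {μ : Measure ℝ}
    [IsFiniteMeasure μ] (hμ : ∀ᵐ x ∂μ, x ∈ Set.Icc 0 M) : Integrable q μ :=
  integrable_comp_of_mem_Icc (M := M) continuous_id hq.continuous.measurable
    (hμ.mono fun _ hx => hq.mem_Icc hx)

theorem integrable_mul_retention {μ : Measure ℝ} (hμ : ∀ᵐ x ∂μ, x ∈ Set.Icc 0 M)
    {φ q : ℝ → ℝ} (hφ : Integrable φ μ) (hq : IsRetention q) :
    Integrable (fun x => φ x * q x) μ := by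
  refine hφ.mul_bdd (c := M) hq.continuous.aestronglyMeasurable ?_
  filter_upwards [hμ] with x hx
  have := hq.mem_Icc hx
  rw [Real.norm_eq_abs, abs_of_nonneg this.1]
  exact this.2

theorem integral_deriv_mul_sub_nonpos {ν : Measure ℝ} [IsFiniteMeasure ν]
    (hν : ∀ᵐ x ∂ν, x ∈ Set.Icc 0 M) {v v' : ℝ → ℝ} (hv : Continuous v)
    (hvc : ConcaveOn ℝ Set.univ v) (hvd : ∀ y, HasDerivAt v (v' y) y) (hv' : Continuous v')
    {r q : ℝ → ℝ} (hr : IsRetention r) (hq : IsRetention q)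
    (hmax : ∀ a ∈ Set.Icc (0 : ℝ) 1,
      ∫ x, v ((1 - a) * r x + a * q x) ∂ν ≤ ∫ x, v (r x) ∂ν) :
    ∫ x, v' (r x) * (q x - r x) ∂ν ≤ 0 := by
  have hcomb : ∀ a ∈ Set.Icc (0 : ℝ) 1, IsRetention fun x => (1 - a) * r x + a * q x :=
    fun a ha => hr.convex_comb hq (by linarith [ha.2]) ha.1 (by ring)
  obtain ⟨C, hC⟩ := Continuous.exists_norm_le_on_Icc hv' M
  have hbd : ∀ a ∈ Set.Icc (0 : ℝ) 1, ∀ᵐ x ∂ν,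
      ‖v' ((1 - a) * r x + a * q x) * (q x - r x)‖ ≤ C * M := by
    intro a ha
    filter_upwards [hν] with x hx
    have h1 := hC _ ((hcomb a ha).mem_Icc hx)
    have h2 := hr.mem_Icc hx
    have h3 := hq.mem_Icc hx
    rw [norm_mul]
    refine mul_le_mul h1 ?_ (norm_nonneg _) ((norm_nonneg _).trans h1)
    rw [Real.norm_eq_abs, abs_le]
    constructor <;> linarith [h2.1, h2.2, h3.1, h3.2]
  have hmeas : ∀ a : ℝ, Continuous fun x => v' ((1 - a) * r x + a * q x) * (q x - r x) := by
    intro a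
    have := hr.continuous
    have := hq.continuous
    fun_prop
  have hstep : ∀ a ∈ Set.Ioc (0 : ℝ) 1,
      ∫ x, v' ((1 - a) * r x + a * q x) * (q x - r x) ∂ν ≤ 0 := by
    intro a ha
    have ha' : a ∈ Set.Icc (0 : ℝ) 1 := ⟨ha.1.le, ha.2⟩
    have hi1 : Integrable (fun x => v ((1 - a) * r x + a * q x)) ν :=
      integrable_comp_of_mem_Icc hv (hcomb a ha').continuous.measurable
        (hν.mono fun _ hx => (hcomb a ha').mem_Icc hx)
    have hi2 : Integrable (fun x => v (r x)) ν :=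
      integrable_comp_of_mem_Icc hv hr.continuous.measurable
        (hν.mono fun _ hx => hr.mem_Icc hx)
    have hi3 : Integrable (fun x => v' ((1 - a) * r x + a * q x) * (q x - r x)) ν :=
      Integrable.of_bound (hmeas a).aestronglyMeasurable _ (hbd a ha')
    have h1 : a * ∫ x, v' ((1 - a) * r x + a * q x) * (q x - r x) ∂ν ≤
        ∫ x, v ((1 - a) * r x + a * q x) ∂ν - ∫ x, v (r x) ∂ν := by
      rw [← integral_const_mul, ← integral_sub hi1 hi2]
      refine integral_mono (hi3.const_mul a) (hi1.sub hi2) fun x => ?_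
      have := hvc.le_add_mul_sub_of_hasDerivAt (hvd ((1 - a) * r x + a * q x)) (r x)
      dsimp only
      linarith
    have h2 := hmax a ha'
    by_contra! h3
    have := mul_pos ha.1 h3
    linarith
  have hseq : ∀ n : ℕ, 1 / ((n : ℝ) + 1) ∈ Set.Ioc (0 : ℝ) 1 := fun n =>
    ⟨by positivity, by rw [div_le_one (by positivity)]; linarith [n.cast_nonneg (α := ℝ)]⟩
  refine le_of_tendsto' (tendsto_integral_of_dominated_convergence (fun _ => C * M)
    (F := fun (n : ℕ) x => v' ((1 - 1 / ((n : ℝ) + 1)) * r x + 1 / ((n : ℝ) + 1) * q x) *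
      (q x - r x)) (fun n => (hmeas _).aestronglyMeasurable) (integrable_const _)
    (fun n => hbd _ ⟨(hseq n).1.le, (hseq n).2⟩) (Filter.Eventually.of_forall fun x => ?_))
    fun n => hstep _ (hseq n)
  have hc : Continuous fun a : ℝ => v' ((1 - a) * r x + a * q x) * (q x - r x) := by fun_prop
  have := (hc.tendsto 0).comp tendsto_one_div_add_atTop_nhds_zero_nat
  simpa [Function.comp_def] using this

theorem exists_retention_multiplier (hM : 0 ≤ M) (μ ν : Measure ℝ) [IsFiniteMeasure μ]
    [IsFiniteMeasure ν] (hμ : ∀ᵐ x ∂μ, x ∈ Set.Icc 0 M) (hν : ∀ᵐ x ∂ν, x ∈ Set.Icc 0 M)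
    {v v' : ℝ → ℝ} (hvc : ConcaveOn ℝ Set.univ v) (hvd : ∀ y, HasDerivAt v (v' y) y)
    (hv' : Continuous v') (hv'0 : ∀ y, v' y ≤ 0) {c : ℝ} (hc0 : 0 < c)
    (hc : c < ∫ x, x ∂μ) :
    ∃ (r : ℝ → ℝ) (l : ℝ), IsRetention r ∧ ∫ x, r x ∂μ = c ∧ 0 ≤ l ∧
      ∀ q, IsRetention q →
        ∫ x, v' (r x) * (q x - r x) ∂ν + l * (∫ x, q x ∂μ - c) ≤ 0 := by
  have hv : Continuous v := continuous_iff_continuousAt.2 fun y => (hvd y).continuousAt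
  have hc1 : 0 < ∫ x, x ∂μ := hc0.trans hc
  have hfeas : ∃ q, IsRetention q ∧ ∫ x, q x ∂μ = c := by
    refine ⟨_, IsRetention.const_mul_id (a := c / ∫ x, x ∂μ)
      ⟨(div_pos hc0 hc1).le, ((div_lt_one hc1).2 hc).le⟩, ?_⟩
    rw [integral_const_mul, div_mul_cancel₀ _ hc1.ne']
  obtain ⟨r, hr, hrc, hmax⟩ := exists_retention_isMax hM μ ν hμ hν hv hfeas
  have hφ : Integrable (fun x => v' (r x)) ν :=
    integrable_comp_of_mem_Icc hv' hr.continuous.measurable (hν.mono fun _ hx => hr.mem_Icc hx)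
  have hlin : ∀ q, IsRetention q → ∫ x, v' (r x) * (q x - r x) ∂ν =
      ∫ x, v' (r x) * q x ∂ν - ∫ x, v' (r x) * r x ∂ν := by
    intro q hq
    simp_rw [mul_sub]
    exact integral_sub (integrable_mul_retention hν hφ hq) (integrable_mul_retention hν hφ hr)
  have hcombμ : ∀ p q, IsRetention p → IsRetention q → ∀ a b : ℝ,
      ∫ x, (a * p x + b * q x) ∂μ = a * ∫ x, p x ∂μ + b * ∫ x, q x ∂μ := by
    intro p q hp hq a b
    rw [integral_add ((hp.integrable hμ).const_mul a) ((hq.integrable hμ).const_mul b),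
      integral_const_mul, integral_const_mul]
  have hcombν : ∀ p q, IsRetention p → IsRetention q → ∀ a b : ℝ,
      ∫ x, v' (r x) * (a * p x + b * q x) ∂ν =
        a * ∫ x, v' (r x) * p x ∂ν + b * ∫ x, v' (r x) * q x ∂ν := by
    intro p q hp hq a b
    rw [← integral_const_mul, ← integral_const_mul,
      ← integral_add ((integrable_mul_retention hν hφ hp).const_mul a)
        ((integrable_mul_retention hν hφ hq).const_mul b)]
    congr 1 with x
    ring
  obtain ⟨l, hl⟩ := Convex.exists_multiplier
    (C := {z : ℝ × ℝ | ∃ q, IsRetention q ∧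
      z = (∫ x, q x ∂μ - c, ∫ x, v' (r x) * (q x - r x) ∂ν)}) (by
      rintro _ ⟨p, hp, rfl⟩ _ ⟨q, hq, rfl⟩ a b ha hb hab
      refine ⟨_, hp.convex_comb hq ha hb hab, ?_⟩
      rw [hlin p hp, hlin q hq, hlin _ (hp.convex_comb hq ha hb hab), hcombμ p q hp hq,
        hcombν p q hp hq]
      ext
      · simp only [Prod.fst_add, Prod.smul_fst, smul_eq_mul]
        linear_combination (-c) * hab
      · simp only [Prod.snd_add, Prod.smul_snd, smul_eq_mul]
        linear_combination (-∫ x, v' (r x) * r x ∂ν) * hab)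
    (by
      rintro y ⟨q, hq, hqy⟩
      obtain ⟨h1, rfl⟩ := Prod.mk.inj hqy
      refine integral_deriv_mul_sub_nonpos hν hv hvc hvd hv' hr hq fun a ha => ?_
      refine hmax _ (hr.convex_comb hq (by linarith [ha.2]) ha.1 (by ring)) ?_
      rw [hcombμ r q hr hq, hrc]
      linear_combination (-a) * h1)
    ⟨_, ⟨_, IsRetention.const_mul_id (a := 1) (by simp), rfl⟩, by simpa using hc⟩
    ⟨_, ⟨_, IsRetention.zero, rfl⟩, by simpa using hc0⟩
  have hl' : ∀ q, IsRetention q →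
      ∫ x, v' (r x) * (q x - r x) ∂ν + -l * (∫ x, q x ∂μ - c) ≤ 0 := fun q hq => by
    have := hl _ ⟨q, hq, rfl⟩
    linarith
  refine ⟨r, -l, hr, hrc, ?_, hl'⟩
  have h1 := hl' _ IsRetention.zero
  have h2 : 0 ≤ ∫ x, v' (r x) * (0 - r x) ∂ν := by
    refine integral_nonneg_of_ae ?_
    filter_upwards [hν] with x hx
    have := (hr.mem_Icc hx).1
    exact mul_nonneg_of_nonpos_of_nonpos (hv'0 _) (by linarith)
  simp only [integral_zero] at h1
  by_contra! h3
  nlinarith [mul_pos_of_neg_of_neg h3 (neg_lt_zero.2 hc0)]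

end FirstOrder

section BangBang

variable {M : ℝ}

theorem measurable_tail_integral (μ : Measure ℝ) [IsFiniteMeasure μ] {φ : ℝ → ℝ}
    (hφ : Measurable φ) (M : ℝ) : Measurable fun t => ∫ x in Set.Icc t M, φ x ∂μ := by
  have h : (fun t => ∫ x in Set.Icc t M, φ x ∂μ) =
      fun t => ∫ x, {p : ℝ × ℝ | p.1 ≤ p.2 ∧ p.2 ≤ M}.indicator (fun p => φ p.2) (t, x) ∂μ := by
    funext t
    rw [← integral_indicator measurableSet_Icc]
    rfl
  rw [h]
  refine (StronglyMeasurable.integral_prod_right' ?_).measurable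
  refine ((hφ.comp measurable_snd).indicator ?_).stronglyMeasurable
  exact (measurableSet_le measurable_fst measurable_snd).inter
    (measurableSet_le measurable_snd measurable_const)

theorem integral_mul_intervalIntegral {μ : Measure ℝ} [IsFiniteMeasure μ]
    (hμ : ∀ᵐ x ∂μ, x ∈ Set.Icc 0 M) {φ g : ℝ → ℝ} (hφ : Integrable φ μ)
    (hg : Measurable g) (hg01 : ∀ t, g t ∈ Set.Icc (0 : ℝ) 1) :
    ∫ x, φ x * (∫ t in (0 : ℝ)..x, g t) ∂μ =
      ∫ t in Set.Ioc 0 M, g t * ∫ x in Set.Icc t M, φ x ∂μ := by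
  set D : Set (ℝ × ℝ) := {p | p.2 ≤ p.1} with hD
  have hDm : MeasurableSet D := measurableSet_le measurable_snd measurable_fst
  have hgi : IntegrableOn g (Set.Ioc 0 M) := by
    refine Measure.integrableOn_of_bounded (M := 1) measure_Ioc_lt_top.ne
      hg.aestronglyMeasurable (Filter.Eventually.of_forall fun t => ?_)
    rw [Real.norm_eq_abs, abs_of_nonneg (hg01 t).1]
    exact (hg01 t).2
  have hint : Integrable (Function.uncurry fun x t => D.indicator (fun p => φ p.1 * g p.2) (x, t))
      (μ.prod (volume.restrict (Set.Ioc 0 M))) := (hφ.mul_prod hgi).indicator hDm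
  calc ∫ x, φ x * (∫ t in (0 : ℝ)..x, g t) ∂μ
      = ∫ x, (∫ t in Set.Ioc 0 M, D.indicator (fun p => φ p.1 * g p.2) (x, t)) ∂μ := by
        refine integral_congr_ae ?_
        filter_upwards [hμ] with x hx
        rw [intervalIntegral.integral_of_le hx.1, ← integral_const_mul]
        have h1 : ∀ t, D.indicator (fun p => φ p.1 * g p.2) (x, t) =
            (Set.Iic x).indicator (fun t => φ x * g t) t := fun t => rfl
        simp_rw [h1]
        rw [setIntegral_indicator measurableSet_Iic, Set.Ioc_inter_Iic, min_eq_right hx.2]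
    _ = ∫ t in Set.Ioc 0 M, ∫ x, D.indicator (fun p => φ p.1 * g p.2) (x, t) ∂μ :=
        integral_integral_swap hint
    _ = ∫ t in Set.Ioc 0 M, g t * ∫ x in Set.Icc t M, φ x ∂μ := by
        congr 1 with t
        rw [← integral_const_mul, ← integral_indicator measurableSet_Icc]
        refine integral_congr_ae ?_
        filter_upwards [hμ] with x hx
        by_cases h : t ≤ x
        · rw [Set.indicator_of_mem (show (x, t) ∈ D from h),
            Set.indicator_of_mem (show x ∈ Set.Icc t M from ⟨h, hx.2⟩), mul_comm]
        · rw [Set.indicator_of_notMem (show (x, t) ∉ D from h),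
            Set.indicator_of_notMem (show x ∉ Set.Icc t M from fun h' => h h'.1)]

theorem exists_bang_bang_deriv {μ : Measure ℝ} [IsFiniteMeasure μ]
    (hμ : ∀ᵐ x ∂μ, x ∈ Set.Icc 0 M) {φ : ℝ → ℝ} (hφm : Measurable φ) (hφ : Integrable φ μ)
    {r : ℝ → ℝ} (hr : IsRetention r)
    (hopt : ∀ q, IsRetention q → ∫ x, φ x * r x ∂μ ≤ ∫ x, φ x * q x ∂μ) :
    ∃ g : ℝ → ℝ, Measurable g ∧ (∀ t, g t ∈ Set.Icc (0 : ℝ) 1) ∧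
      (∀ x ∈ Set.Icc 0 M, r x = ∫ t in (0 : ℝ)..x, g t) ∧
      ∀ t, (0 < ∫ x in Set.Icc t M, φ x ∂μ → g t = 0) ∧
        (∫ x in Set.Icc t M, φ x ∂μ < 0 → g t = 1) := by
  set F : ℝ → ℝ := fun t => ∫ x in Set.Icc t M, φ x ∂μ with hF
  have hFm : Measurable F := measurable_tail_integral μ hφm M
  have hFb : ∀ t, ‖F t‖ ≤ ∫ x, ‖φ x‖ ∂μ := fun t =>
    (norm_integral_le_integral_norm _).trans
      (setIntegral_le_integral hφ.norm (Filter.Eventually.of_forall fun _ => norm_nonneg _))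
  set g : ℝ → ℝ := fun t => if 0 < F t then 0 else if F t < 0 then 1 else deriv r t with hg
  have hgm : Measurable g := Measurable.ite (measurableSet_lt measurable_const hFm)
    measurable_const (Measurable.ite (measurableSet_lt hFm measurable_const)
      measurable_const (measurable_deriv r))
  have hd01 : ∀ t, deriv r t ∈ Set.Icc (0 : ℝ) 1 := fun t => hr.deriv_mem_Icc
  have hg01 : ∀ t, g t ∈ Set.Icc (0 : ℝ) 1 := by
    intro t
    simp only [hg]
    split_ifs
    · simp
    · simp
    · exact hd01 t
  have hmul : ∀ k : ℝ → ℝ, Measurable k → (∀ t, k t ∈ Set.Icc (0 : ℝ) 1) →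
      IntegrableOn (fun t => k t * F t) (Set.Ioc 0 M) := by
    intro k hk hk01
    refine Measure.integrableOn_of_bounded (M := ∫ x, ‖φ x‖ ∂μ) measure_Ioc_lt_top.ne
      (hk.mul hFm).aestronglyMeasurable (Filter.Eventually.of_forall fun t => ?_)
    rw [norm_mul, Real.norm_eq_abs (k t), abs_of_nonneg (hk01 t).1]
    exact (mul_le_of_le_one_left (norm_nonneg _) (hk01 t).2).trans (hFb t)
  have hle : ∀ t, g t * F t ≤ deriv r t * F t := by
    intro t
    simp only [hg]
    split_ifs with h1 h2
    · nlinarith [(hd01 t).1]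
    · nlinarith [(hd01 t).2]
    · exact le_rfl
  have h1 := hopt _ (IsRetention.intervalIntegral_of_mem_Icc hgm hg01)
  rw [integral_mul_intervalIntegral hμ hφ hgm hg01] at h1
  have h2 := integral_mul_intervalIntegral hμ hφ (measurable_deriv r) hd01
  simp_rw [hr.integral_deriv] at h2
  rw [h2] at h1
  have h3 : (fun t => deriv r t * F t - g t * F t) =ᵐ[volume.restrict (Set.Ioc 0 M)] 0 := by
    rw [← integral_eq_zero_iff_of_nonneg (fun t => sub_nonneg.2 (hle t))
      ((hmul _ (measurable_deriv r) hd01).sub (hmul _ hgm hg01))]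
    rw [integral_sub (hmul _ (measurable_deriv r) hd01) (hmul _ hgm hg01)]
    refine le_antisymm (sub_nonpos.2 h1) (sub_nonneg.2 ?_)
    exact integral_mono (hmul _ hgm hg01) (hmul _ (measurable_deriv r) hd01) hle
  have h4 : ∀ᵐ t, t ∈ Set.Ioc 0 M → deriv r t = g t := by
    rw [← ae_restrict_iff' measurableSet_Ioc]
    filter_upwards [h3] with t ht
    rw [← sub_mul] at ht
    rcases mul_eq_zero.1 ht with h | h
    · exact sub_eq_zero.1 h
    · simp [hg, h]
  refine ⟨g, hgm, hg01, fun x hx => ?_, fun t => ⟨fun h => if_pos h, fun h => ?_⟩⟩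
  · rw [← hr.integral_deriv x]
    refine intervalIntegral.integral_congr_ae ?_
    filter_upwards [h4] with t ht htx
    rw [Set.uIoc_of_le hx.1] at htx
    exact ht ⟨htx.1, htx.2.trans hx.2⟩
  · simp only [hg]
    rw [if_neg (not_lt.2 h.le), if_pos h]

end BangBang

theorem restrict_map_inter_image {S : Type*} [MeasurableSpace S] {X : S → ℝ}
    (hX : Measurable X) {Q : Measure S} {A : Set S} (hA : Q Aᶜ = 0) (B : Set ℝ)
    (hB : MeasurableSet B) : (Q.map X).restrict (B ∩ X '' A) = (Q.map X).restrict B := by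
  ext C hC
  rw [Measure.restrict_apply hC, Measure.restrict_apply hC]
  refine le_antisymm (measure_mono (Set.inter_subset_inter_right _ Set.inter_subset_left)) ?_
  set T := toMeasurable (Q.map X) (C ∩ (B ∩ X '' A)) with hT
  rw [← measure_toMeasurable (C ∩ (B ∩ X '' A)), Measure.map_apply hX (hC.inter hB),
    Measure.map_apply hX (measurableSet_toMeasurable _ _)]
  refine (measure_mono (t := X ⁻¹' T ∪ Aᶜ) fun s hs => ?_).trans
    ((measure_union_le _ _).trans (by rw [hA, add_zero]))
  by_cases h : s ∈ A
  · exact Or.inl (subset_toMeasurable _ _ ⟨hs.1, hs.2, s, h, rfl⟩)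
  · exact Or.inr h

/-- Proposition 4.2 (risk-neutral insurer, no-sabotage condition, fixed worst-case
prior): with `P = P_ac + P_s` the Lebesgue decomposition of `P` w.r.t. `Q`, `A` carrying
`Q` with `P_s(A) = 0`, `h = dP_ac/dQ = ξ ∘ X`, and `u` strictly increasing, concave, `C¹`,
and `(1+ρ)E_Q[X] > π₀ > 0`, the problem of maximizing `E_P[u(W₀−X+Y−π₀)]` over `Y ∈ 𝓘̂`
subject to `(1+ρ)E_Q[Y] ≤ π₀` admits an optimal solution
`Y* = (X − r̂* ∘ X)·1_A + X·1_{S∖A}` (in `𝓘̂` `Q`-a.s.) with `r̂*(x) = ∫₀ˣ (r̂*)'(t) dt`,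
a multiplier `λ* ≥ 0` making the budget bind, and the marginal retention `(r̂*)'` equal
to `0`, `κ(t)` or `1` according as
`∫_{[t,M] ∩ X(A)} [u'(W₀ − r̂*(x) − π₀)ξ(x) − λ*] d(Q∘X⁻¹)(x)` is positive, zero, or
negative. -/
theorem optimal_retention_no_sabotage_risk_neutral {S : Type*} [MeasurableSpace S]
    (M : ℝ) (hM : 0 < M)
    (X : S → ℝ) (hXm : Measurable X) (hX : ∀ s, X s ∈ Set.Icc (0:ℝ) M)
    (Q P Pac Ps : Measure S) [IsProbabilityMeasure Q] [IsProbabilityMeasure P]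
    (hdec : P = Pac + Ps) (hac : Pac ≪ Q)
    (A : Set S) (hAm : MeasurableSet A) (hQA : Q Aᶜ = 0) (hPsA : Ps A = 0)
    (h : S → ℝ) (hhm : Measurable h) (hh0 : ∀ s, 0 ≤ h s)
    (hhd : Pac = Q.withDensity fun s => ENNReal.ofReal (h s))
    (ξ : ℝ → ℝ) (hξm : Measurable ξ) (hξ0 : ∀ x, 0 ≤ ξ x) (hhξ : ∀ s, h s = ξ (X s))
    (W₀ π₀ ρ : ℝ) (hπ : 0 < π₀) (hρ : 0 ≤ ρ)
    (hbudget : π₀ < (1 + ρ) * ∫ s, X s ∂Q)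
    (u u' : ℝ → ℝ)
    (hu : StrictMono u) (hucc : ConcaveOn ℝ Set.univ u)
    (hud : ∀ x, HasDerivAt u (u' x) x) (hu'c : Continuous u') :
    ∃ (rstar g κ : ℝ → ℝ) (lam : ℝ) (Ystar : S → ℝ), 0 ≤ lam ∧
      Measurable κ ∧ (∀ t, κ t ∈ Set.Icc (0:ℝ) 1) ∧
      -- `r̂*` is the integral of its marginal retention `g = (r̂*)'`
      (∀ x ∈ Set.Icc (0:ℝ) M, rstar x = ∫ t in (0:ℝ)..x, g t) ∧
      -- trichotomy for the marginal retention
      (∀ t ∈ Set.Icc (0:ℝ) M,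
        (0 < (∫ x in Set.Icc t M ∩ X '' A,
            (u' (W₀ - rstar x - π₀) * ξ x - lam) ∂(Q.map X)) → g t = 0) ∧
        ((∫ x in Set.Icc t M ∩ X '' A,
            (u' (W₀ - rstar x - π₀) * ξ x - lam) ∂(Q.map X)) = 0 → g t = κ t) ∧
        ((∫ x in Set.Icc t M ∩ X '' A,
            (u' (W₀ - rstar x - π₀) * ξ x - lam) ∂(Q.map X)) < 0 → g t = 1)) ∧
      -- the form of the optimal indemnity
      Ystar = (fun s => A.indicator (fun t => X t - rstar (X t)) s + Aᶜ.indicator X s) ∧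
      -- `Y*` lies in `𝓘̂` Q-almost surely
      (∃ Z : S → ℝ, NoSabotage M X Z ∧ ∀ᵐ s ∂Q, Ystar s = Z s) ∧
      -- the budget constraint binds at the optimum
      (1 + ρ) * (∫ s, Ystar s ∂Q) = π₀ ∧
      -- optimality among no-sabotage indemnities satisfying the budget constraint
      (∀ Y : S → ℝ, NoSabotage M X Y →
        (1 + ρ) * (∫ s, Y s ∂Q) ≤ π₀ →
        (∫ s, u (W₀ - X s + Y s - π₀) ∂P) ≤ ∫ s, u (W₀ - X s + Ystar s - π₀) ∂P) := by
  set μ := Q.map X with hμdef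
  have : IsProbabilityMeasure μ := Measure.isProbabilityMeasure_map hXm.aemeasurable
  have : IsFiniteMeasure Pac := isFiniteMeasure_of_le P (hdec ▸ Measure.le_add_right le_rfl)
  have : IsFiniteMeasure Ps := isFiniteMeasure_of_le P (hdec ▸ Measure.le_add_left le_rfl)
  set ν := Pac.map X with hνdef
  have hsupp : ∀ m : Measure S, ∀ᵐ x ∂m.map X, x ∈ Set.Icc 0 M := fun m =>
    (ae_map_iff hXm.aemeasurable measurableSet_Icc).2 (Filter.Eventually.of_forall hX)
  have hμ := hsupp Q
  have hν := hsupp Pac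
  have hhlt : ∀ᵐ s ∂Q, ENNReal.ofReal (h s) < ⊤ :=
    Filter.Eventually.of_forall fun _ => ENNReal.ofReal_lt_top
  have hhe : Measurable fun s => ENNReal.ofReal (h s) := hhm.ennreal_ofReal
  have hξi : Integrable ξ μ := by
    rw [hμdef, integrable_map_measure hξm.aestronglyMeasurable hXm.aemeasurable]
    have h1 : Integrable (fun _ : S => (1 : ℝ)) Pac := integrable_const 1
    rw [hhd, integrable_withDensity_iff_integrable_smul' hhe hhlt] at h1
    refine h1.congr (Filter.Eventually.of_forall fun s => ?_)
    simp [hhξ, hξ0]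
  have hνint : ∀ f : ℝ → ℝ, Measurable f → ∫ x, f x ∂ν = ∫ x, ξ x * f x ∂μ := by
    intro f hf
    rw [hνdef, hμdef, integral_map hXm.aemeasurable hf.aestronglyMeasurable,
      integral_map (f := fun x => ξ x * f x) hXm.aemeasurable
        (hξm.mul hf).aestronglyMeasurable, hhd,
      integral_withDensity_eq_integral_toReal_smul hhe hhlt]
    congr 1 with s
    rw [ENNReal.toReal_ofReal (hh0 s), hhξ, smul_eq_mul]
  set v : ℝ → ℝ := fun y => u (W₀ - y - π₀) with hvdef
  set v' : ℝ → ℝ := fun y => -u' (W₀ - y - π₀) with hv'def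
  have hvd : ∀ y, HasDerivAt v (v' y) y := by
    intro y
    have h1 : HasDerivAt (fun y => W₀ - y - π₀) (-1) y :=
      ((hasDerivAt_id y).const_sub W₀).sub_const π₀
    simpa [hv'def, hvdef, Function.comp_def] using (hud (W₀ - y - π₀)).comp y h1
  have hvcont : Continuous v := continuous_iff_continuousAt.2 fun y => (hvd y).continuousAt
  have hvc : ConcaveOn ℝ Set.univ v := by
    refine ⟨convex_univ, fun x _ y _ a b ha hb hab => ?_⟩
    have := hucc.2 (Set.mem_univ (W₀ - x - π₀)) (Set.mem_univ (W₀ - y - π₀)) ha hb hab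
    refine this.trans (le_of_eq ?_)
    simp only [hvdef, smul_eq_mul]
    congr 1
    linear_combination (W₀ - π₀) * hab
  have hu'0 : ∀ y, 0 ≤ u' y := fun y => by
    rw [← (hud y).deriv]
    exact hu.monotone.deriv_nonneg
  have hv'c : Continuous v' := by fun_prop
  have hρ1 : 0 < 1 + ρ := by linarith
  have hEX : ∫ x, x ∂μ = ∫ s, X s ∂Q :=
    integral_map hXm.aemeasurable measurable_id.aestronglyMeasurable
  have hXi : ∀ m : Measure S, IsFiniteMeasure m → Integrable X m := fun m _ =>
    integrable_comp_of_mem_Icc (M := M) continuous_id hXm (Filter.Eventually.of_forall hX)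
  set c := ∫ s, X s ∂Q - π₀ / (1 + ρ) with hcdef
  have hc0 : 0 < c := by
    rw [hcdef, sub_pos, div_lt_iff₀ hρ1]
    linarith
  have hc : c < ∫ x, x ∂μ := by
    rw [hEX, hcdef]
    linarith [div_pos hπ hρ1]
  obtain ⟨r, l, hr, hrc, hl, hopt⟩ := exists_retention_multiplier hM.le μ ν hμ hν hvc hvd hv'c
    (fun y => neg_nonpos.2 (hu'0 _)) hc0 hc
  have hrm := hr.continuous.measurable
  set φ : ℝ → ℝ := fun x => u' (W₀ - r x - π₀) * ξ x - l with hφdef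
  have hu'r : Continuous fun x => u' (W₀ - r x - π₀) := by
    have := hr.continuous
    fun_prop
  have hφm : Measurable φ := (hu'r.measurable.mul hξm).sub_const l
  have hφ : Integrable φ μ := by
    refine Integrable.sub ?_ (integrable_const l)
    obtain ⟨C, hC⟩ := Continuous.exists_norm_le_on_Icc hv'c M
    refine hξi.bdd_mul (c := C) hu'r.aestronglyMeasurable ?_
    filter_upwards [hμ] with x hx
    simpa [hv'def] using hC _ (hr.mem_Icc hx)
  have hφopt : ∀ q, IsRetention q → ∫ x, φ x * r x ∂μ ≤ ∫ x, φ x * q x ∂μ := by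
    intro q hq
    have hqm := hq.continuous.measurable
    have h1 := hopt q hq
    have hqi := hq.integrable hμ
    have hri := hr.integrable hμ
    have h2 : ∫ x, v' (r x) * (q x - r x) ∂ν + l * (∫ x, q x ∂μ - c) =
        ∫ x, φ x * r x ∂μ - ∫ x, φ x * q x ∂μ := by
      have hφq := integrable_mul_retention hμ hφ hq
      have hφr := integrable_mul_retention hμ hφ hr
      have h3 : ∫ x, v' (r x) * (q x - r x) ∂ν =
          ∫ x, ((φ x * r x - φ x * q x) - l * (q x - r x)) ∂μ := by
        rw [hνint (fun x => v' (r x) * (q x - r x))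
          ((hv'c.measurable.comp hrm).mul (hqm.sub hrm))]
        congr 1 with x
        simp only [hφdef, hv'def]
        ring
      have h4 : ∫ x, ((φ x * r x - φ x * q x) - l * (q x - r x)) ∂μ =
          ∫ x, (φ x * r x - φ x * q x) ∂μ - ∫ x, l * (q x - r x) ∂μ :=
        integral_sub (hφr.sub hφq) ((hqi.sub hri).const_mul l)
      rw [h3, h4, integral_sub hφr hφq, integral_const_mul, integral_sub hqi hri, hrc]
      ring
    linarith
  obtain ⟨g, hgm, hg01, hgr, hgF⟩ := exists_bang_bang_deriv hμ hφm hφ hr hφopt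
  set Ystar : S → ℝ :=
    fun s => A.indicator (fun t => X t - r (X t)) s + Aᶜ.indicator X s with hYdef
  have hYA : ∀ s ∈ A, Ystar s = X s - r (X s) := fun s hs => by
    simp [hYdef, hs]
  have hYAc : ∀ s ∉ A, Ystar s = X s := fun s hs => by
    simp [hYdef, hs]
  have hAQ : ∀ᵐ s ∂Q, s ∈ A := hQA
  have hAPac : ∀ᵐ s ∂Pac, s ∈ A := hac hQA
  have hAPs : ∀ᵐ s ∂Ps, s ∉ A := by
    rw [ae_iff]
    simpa using hPsA
  have hEr : ∫ s, r (X s) ∂Q = c := by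
    rw [← hrc, hμdef, integral_map hXm.aemeasurable hrm.aestronglyMeasurable]
  have hcomp : ∀ (m : Measure S) (q : ℝ → ℝ), IsFiniteMeasure m → IsRetention q →
      Integrable (fun s => q (X s)) m := fun m q _ hq =>
    integrable_comp_of_mem_Icc (M := M) hq.continuous hXm (Filter.Eventually.of_forall hX)
  refine ⟨r, g, g, l, Ystar, hl, hgm, hg01, hgr, fun t _ => ?_, rfl, ?_, ?_, ?_⟩
  · rw [restrict_map_inter_image hXm hQA _ measurableSet_Icc]
    exact ⟨(hgF t).1, fun _ => rfl, (hgF t).2⟩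
  · refine ⟨fun s => X s - r (X s), ⟨fun x => x - r x, by simp [hr.1], ?_, fun _ => rfl⟩, ?_⟩
    · intro x₁ x₂ _ h21 _
      have h1 := hr.2.1 h21
      have h2 := hr.sub_le h21
      constructor <;> linarith
    · filter_upwards [hAQ] with s hs using hYA s hs
  · have h1 : ∫ s, Ystar s ∂Q = ∫ s, (X s - r (X s)) ∂Q :=
      integral_congr_ae (hAQ.mono hYA)
    rw [h1, integral_sub (hXi Q inferInstance) (hcomp Q r inferInstance hr), hEr, hcdef,
      sub_sub_cancel, mul_div_cancel₀ _ hρ1.ne']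
  · rintro Y ⟨I, hI0, hI, hYI⟩ hYb
    set q : ℝ → ℝ := fun x => max 0 (min x M) - I (max 0 (min x M)) with hqdef
    have hq : IsRetention q := IsRetention.of_indemnity hM.le hI0 hI
    have hqm := hq.continuous.measurable
    have hYq : ∀ s, Y s = X s - q (X s) := fun s => by
      simp [hqdef, hYI, (hX s).1, (hX s).2]
    have hYeq : Y = fun s => X s - q (X s) := funext hYq
    have hrate : ∀ s, u (W₀ - X s + Y s - π₀) = v (q (X s)) := fun s => by
      simp only [hvdef, hYq]
      congr 1
      ring
    have hvX : ∀ (m : Measure S) (k : ℝ → ℝ), IsFiniteMeasure m → IsRetention k →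
        Integrable (fun s => v (k (X s))) m := fun m k _ hk =>
      integrable_comp_of_mem_Icc hvcont (hk.continuous.measurable.comp hXm)
        (Filter.Eventually.of_forall fun s => hk.mem_Icc (hX s))
    have hqc : c ≤ ∫ x, q x ∂μ := by
      rw [hμdef, integral_map hXm.aemeasurable hqm.aestronglyMeasurable]
      rw [hYeq, integral_sub (hXi Q inferInstance) (hcomp Q q inferInstance hq)] at hYb
      have := (le_div_iff₀' hρ1).2 hYb
      linarith
    have hνle : ∫ x, v (q x) ∂ν ≤ ∫ x, v (r x) ∂ν := by
      have hk : ∀ k, IsRetention k → Integrable (fun x => v (k x)) ν := fun k hk =>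
        integrable_comp_of_mem_Icc hvcont hk.continuous.measurable
          (hν.mono fun _ hx => hk.mem_Icc hx)
      have hv'r : Integrable (fun x => v' (r x)) ν :=
        integrable_comp_of_mem_Icc hv'c hrm (hν.mono fun _ hx => hr.mem_Icc hx)
      have hd : Integrable (fun x => v' (r x) * (q x - r x)) ν := by
        simp_rw [mul_sub]
        exact (integrable_mul_retention hν hv'r hq).sub (integrable_mul_retention hν hv'r hr)
      have h1 : ∫ x, v (q x) ∂ν ≤ ∫ x, (v (r x) + v' (r x) * (q x - r x)) ∂ν :=
        integral_mono (hk q hq) ((hk r hr).add hd) fun x =>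
          hvc.le_add_mul_sub_of_hasDerivAt (hvd (r x)) (q x)
      rw [integral_add (hk r hr) hd] at h1
      have h2 := hopt q hq
      have h3 := mul_nonneg hl (sub_nonneg.2 hqc)
      linarith
    have hPac : ∫ s, u (W₀ - X s + Y s - π₀) ∂Pac ≤ ∫ s, u (W₀ - X s + Ystar s - π₀) ∂Pac := by
      have h1 : ∫ s, u (W₀ - X s + Ystar s - π₀) ∂Pac = ∫ s, v (r (X s)) ∂Pac := by
        refine integral_congr_ae ?_
        filter_upwards [hAPac] with s hs
        rw [hYA s hs]
        simp only [hvdef]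
        congr 1
        ring
      rw [h1]
      simp_rw [hrate]
      rwa [hνdef, integral_map (f := fun x => v (q x)) hXm.aemeasurable
          (hvcont.measurable.comp hqm).aestronglyMeasurable,
        integral_map (f := fun x => v (r x)) hXm.aemeasurable
          (hvcont.measurable.comp hrm).aestronglyMeasurable] at hνle
    have hstar_s : (fun s => u (W₀ - X s + Ystar s - π₀)) =ᵐ[Ps] fun _ => v 0 := by
      filter_upwards [hAPs] with s hs
      rw [hYAc s hs]
      simp only [hvdef]
      congr 1
      ring
    have hPs : ∫ s, u (W₀ - X s + Y s - π₀) ∂Ps ≤ ∫ s, u (W₀ - X s + Ystar s - π₀) ∂Ps := by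
      rw [integral_congr_ae hstar_s]
      simp_rw [hrate]
      refine integral_mono (hvX Ps q inferInstance hq) (integrable_const _) fun s => ?_
      refine hu.monotone ?_
      have := (hq.mem_Icc (hX s)).1
      linarith
    have hstar_ac : Integrable (fun s => u (W₀ - X s + Ystar s - π₀)) Pac := by
      refine (hvX Pac r inferInstance hr).congr ?_
      filter_upwards [hAPac] with s hs
      rw [hYA s hs]
      simp only [hvdef]
      congr 1
      ring
    have hYint : ∀ m : Measure S, IsFiniteMeasure m →
        Integrable (fun s => u (W₀ - X s + Y s - π₀)) m := fun m hm => by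
      simp_rw [hrate]
      exact hvX m q hm hq
    rw [hdec, integral_add_measure (hYint Pac inferInstance) (hYint Ps inferInstance),
      integral_add_measure hstar_ac ((integrable_const _).congr hstar_s.symm)]
    exact add_le_add hPac hPs
end

section
/- Let (S,Σ) be a measurable space, M > 0, X : S → [0,M] measurable, Q and P probability measures on (S,Σ), with Lebesgue decomposition P = P_ac + P_s with respect to Q, A ∈ Σ such that Q(S∖A) = P_s(A) = 0, and h = dP_ac/dQ; set A_h := {s ∈ A : h(s) = 0}, and for λ ≥ 0 set A_λ⁻ := {s ∈ A : h(s) < λ} and A_λ⁰ := {s ∈ A : h(s) = λ}. Let Π̃₀ := E_Q[X] − (1+ρ)⁻¹Π₀ and assume Π̃₀ > 0. Then the problem of minimizing E_P[R] over retentions R ∈ 𝓘 subject to E_Q[R] ≥ Π̃₀ admits an optimal solution R* supported on A of the following form: (Case 1) if E_Q[X·1_{A_h}] < Π̃₀, then R* = X·1_{A⁻_{λ*}} + c·X·1_{A⁰_{λ*}} for some λ* > 0 with E_Q[R*] = Π̃₀, where c = 0 if E_Q[X·1_{A⁻_{λ*}}] = Π̃₀ and c = (Π̃₀ − E_Q[X·1_{A⁻_{λ*}}])/E_Q[X·1_{A⁰_{λ*}}]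 ∈ (0,1] otherwise; (Case 2) if E_Q[X·1_{A_h}] ≥ Π̃₀, then R* = c₀·X·1_{A_h} with c₀ := Π̃₀/E_Q[X·1_{A_h}] ∈ (0,1]. The corresponding optimal indemnity is Y* = (X − R*)·1_A + X·1_{S∖A}. -/
open MeasureTheory

/-- A level `lam > 0` at which the distribution function of `h` on `A`, weighted by a nonnegative
integrable `f`, crosses the value `v`. -/
lemma exists_level_setIntegral {S : Type*} [MeasurableSpace S] {μ : Measure S} {f h : S → ℝ}
    {A : Set S} {v : ℝ} (hf : Integrable f μ) (hf0 : ∀ s, 0 ≤ f s) (hh : Measurable h)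
    (hA : MeasurableSet A) (hlow : ∫ s in {t | t ∈ A ∧ h t ≤ 0}, f s ∂μ < v)
    (hhigh : v < ∫ s in A, f s ∂μ) :
    ∃ lam : ℝ, 0 < lam ∧ ∫ s in {t | t ∈ A ∧ h t < lam}, f s ∂μ ≤ v ∧
      v ≤ ∫ s in {t | t ∈ A ∧ h t ≤ lam}, f s ∂μ := by
  set F : ℝ → ℝ := fun l => ∫ s in {t | t ∈ A ∧ h t ≤ l}, f s ∂μ
  have hmeas : ∀ l, MeasurableSet {t | t ∈ A ∧ h t ≤ l} := fun l =>
    hA.inter (measurableSet_le hh measurable_const)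
  have hsub : ∀ {l l' : ℝ}, l ≤ l' → {t | t ∈ A ∧ h t ≤ l} ⊆ {t | t ∈ A ∧ h t ≤ l'} :=
    fun hl t ht => ⟨ht.1, ht.2.trans hl⟩
  have hmono : Monotone F := fun l l' hl =>
    setIntegral_mono_set hf.integrableOn (Filter.Eventually.of_forall hf0) (hsub hl).eventuallyLE
  set T : Set ℝ := {l | v ≤ F l}
  have hne : T.Nonempty := by
    have hU : (⋃ n : ℕ, {t | t ∈ A ∧ h t ≤ (n : ℝ)}) = A := by
      ext t
      simp only [Set.mem_iUnion, Set.mem_ofPred_eq]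
      exact ⟨fun ⟨_, ht⟩ => ht.1, fun ht => (exists_nat_ge (h t)).imp fun _ hn => ⟨ht, hn⟩⟩
    have ht := tendsto_setIntegral_of_monotone (f := f) (μ := μ)
      (fun n : ℕ => hmeas (n : ℝ)) (fun m n hmn => hsub (Nat.cast_le.mpr hmn)) hf.integrableOn
    rw [hU] at ht
    obtain ⟨n, hn⟩ := (ht.eventually (lt_mem_nhds hhigh)).exists
    exact ⟨n, hn.le⟩
  have hpos : ∀ l ∈ T, 0 < l := fun l hl => by
    by_contra! hl0
    exact absurd (lt_of_le_of_lt (hmono hl0) hlow) (not_lt.mpr hl)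
  have hbdd : BddBelow T := ⟨0, fun l hl => (hpos l hl).le⟩
  have hright : sInf T ∈ T := by
    have hI : (⋂ n : ℕ, {t | t ∈ A ∧ h t ≤ sInf T + 1 / ((n : ℝ) + 1)})
        = {t | t ∈ A ∧ h t ≤ sInf T} := by
      ext t
      simp only [Set.mem_iInter, Set.mem_ofPred_eq]
      refine ⟨fun ht => ⟨(ht 0).1, ?_⟩, fun ht n => ⟨ht.1, ?_⟩⟩
      · by_contra! hlt
        obtain ⟨n, hn⟩ := exists_nat_one_div_lt (sub_pos.mpr hlt)
        linarith [(ht n).2]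
      · have : (0 : ℝ) < 1 / ((n : ℝ) + 1) := by positivity
        linarith [ht.2]
    have ht := tendsto_setIntegral_of_antitone (f := f) (μ := μ)
      (fun n : ℕ => hmeas (sInf T + 1 / ((n : ℝ) + 1)))
      (fun m n hmn => hsub (by have := Nat.one_div_le_one_div (α := ℝ) hmn; linarith))
      ⟨0, hf.integrableOn⟩
    rw [hI] at ht
    refine ge_of_tendsto' ht fun n => ?_
    have hn : (0 : ℝ) < 1 / ((n : ℝ) + 1) := by positivity
    obtain ⟨l, hl, hlt⟩ := exists_lt_of_csInf_lt hne (lt_add_of_pos_right (sInf T) hn)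
    exact le_trans hl (hmono hlt.le)
  refine ⟨sInf T, hpos _ hright, ?_, hright⟩
  have hU : (⋃ n : ℕ, {t | t ∈ A ∧ h t ≤ sInf T - 1 / ((n : ℝ) + 1)})
      = {t | t ∈ A ∧ h t < sInf T} := by
    ext t
    simp only [Set.mem_iUnion, Set.mem_ofPred_eq]
    refine ⟨fun ⟨n, ht⟩ => ⟨ht.1, ?_⟩, fun ht => ?_⟩
    · have : (0 : ℝ) < 1 / ((n : ℝ) + 1) := by positivity
      linarith [ht.2]
    · obtain ⟨n, hn⟩ := exists_nat_one_div_lt (sub_pos.mpr ht.2)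
      exact ⟨n, ht.1, by linarith⟩
  have ht := tendsto_setIntegral_of_monotone (f := f) (μ := μ)
    (fun n : ℕ => hmeas (sInf T - 1 / ((n : ℝ) + 1)))
    (fun m n hmn => hsub (by have := Nat.one_div_le_one_div (α := ℝ) hmn; linarith))
    hf.integrableOn
  rw [hU] at ht
  refine le_of_tendsto' ht fun n => ?_
  have hn : (0 : ℝ) < 1 / ((n : ℝ) + 1) := by positivity
  by_contra! hlt
  have := csInf_le hbdd (show sInf T - 1 / ((n : ℝ) + 1) ∈ T from hlt.le)
  linarith

/-- Neyman–Pearson: a threshold retention at level `lam` is cheapest under `P` among all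
retentions whose `Q`-expectation is at least as large. -/
lemma integral_threshold_le {S : Type*} [MeasurableSpace S] {M : ℝ} {X : S → ℝ}
    (hXM : ∀ s, X s ≤ M) {Q P Pac Ps : Measure S} [IsFiniteMeasure Q] [IsFiniteMeasure P]
    (hdec : P = Pac + Ps) {A : Set S} (hQA : Q Aᶜ = 0) (hPsA : Ps A = 0)
    {h : S → ℝ} (hhm : Measurable h) (hh0 : ∀ s, 0 ≤ h s)
    (hhd : Pac = Q.withDensity fun s => ENNReal.ofReal (h s))
    {lam : ℝ} (hlam : 0 ≤ lam) {R₀ R : S → ℝ}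
    (hR₀m : Measurable R₀) (hR₀ : ∀ s, 0 ≤ R₀ s ∧ R₀ s ≤ X s) (hR₀A : ∀ s ∉ A, R₀ s = 0)
    (hlt : ∀ s ∈ A, h s < lam → R₀ s = X s) (hgt : ∀ s ∈ A, lam < h s → R₀ s = 0)
    (hRm : Measurable R) (hR : ∀ s, 0 ≤ R s ∧ R s ≤ X s)
    (hle : ∫ s, R₀ s ∂Q ≤ ∫ s, R s ∂Q) :
    ∫ s, R₀ s ∂P ≤ ∫ s, R s ∂P := by
  have hfPac : IsFiniteMeasure Pac :=
    isFiniteMeasure_of_le P (hdec ▸ Measure.le_add_right le_rfl)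
  have hfPs : IsFiniteMeasure Ps :=
    isFiniteMeasure_of_le P (hdec ▸ Measure.le_add_left le_rfl)
  have hint : ∀ (μ : Measure S) [IsFiniteMeasure μ] (g : S → ℝ), Measurable g →
      (∀ s, 0 ≤ g s ∧ g s ≤ X s) → Integrable g μ := fun μ _ g hg hgX =>
    Integrable.of_bound hg.aestronglyMeasurable M <| Filter.Eventually.of_forall fun s => by
      rw [Real.norm_of_nonneg (hgX s).1]
      exact (hgX s).2.trans (hXM s)
  have hsplit : ∀ g : S → ℝ, Measurable g → (∀ s, 0 ≤ g s ∧ g s ≤ X s) →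
      ∫ s, g s ∂P = ∫ s, h s * g s ∂Q + ∫ s, g s ∂Ps := fun g hg hgX => by
    rw [hdec, integral_add_measure (hint Pac g hg hgX) (hint Ps g hg hgX), hhd,
      integral_withDensity_eq_integral_toReal_smul hhm.ennreal_ofReal
        (Filter.Eventually.of_forall fun _ => ENNReal.ofReal_lt_top)]
    simp only [ENNReal.toReal_ofReal (hh0 _), smul_eq_mul]
  have hinth : ∀ g : S → ℝ, Measurable g → (∀ s, 0 ≤ g s ∧ g s ≤ X s) →
      Integrable (fun s => h s * g s) Q := fun g hg hgX => by
    have hi := hint Pac g hg hgX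
    rw [hhd, integrable_withDensity_iff_integrable_smul' hhm.ennreal_ofReal
      (Filter.Eventually.of_forall fun _ => ENNReal.ofReal_lt_top)] at hi
    simpa only [ENNReal.toReal_ofReal (hh0 _), smul_eq_mul] using hi
  have hR₀s : ∫ s, R₀ s ∂Ps = 0 := by
    refine integral_eq_zero_of_ae ?_
    filter_upwards [measure_eq_zero_iff_ae_notMem.mp hPsA] with s hs using hR₀A s hs
  have hRs : 0 ≤ ∫ s, R s ∂Ps := integral_nonneg fun s => (hR s).1
  have key : ∫ s, lam * (R s - R₀ s) ∂Q ≤ ∫ s, (h s * R s - h s * R₀ s) ∂Q := by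
    refine integral_mono_ae (((hint Q R hRm hR).sub (hint Q R₀ hR₀m hR₀)).const_mul lam)
      ((hinth R hRm hR).sub (hinth R₀ hR₀m hR₀)) ?_
    filter_upwards [measure_eq_zero_iff_ae_notMem.mp hQA] with s hs
    have hsA : s ∈ A := not_not.mp hs
    rcases lt_trichotomy (h s) lam with hl | hl | hl
    · rw [hlt s hsA hl]
      nlinarith [(hR s).2]
    · rw [hl, mul_sub]
    · rw [hgt s hsA hl]
      nlinarith [(hR s).1]
  rw [integral_const_mul, integral_sub (hint Q R hRm hR) (hint Q R₀ hR₀m hR₀),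
    integral_sub (hinth R hRm hR) (hinth R₀ hR₀m hR₀)] at key
  rw [hsplit R hRm hR, hsplit R₀ hR₀m hR₀, hR₀s]
  linarith [mul_nonneg hlam (sub_nonneg.mpr hle)]

/-- Proposition 4.3 (both agents risk-neutral, no no-sabotage condition, fixed
worst-case prior): with `P = P_ac + P_s` the Lebesgue decomposition of `P` w.r.t. `Q`,
`A` carrying `Q` with `P_s(A) = 0`, `h = dP_ac/dQ`, `A_h = {h = 0} ∩ A`,
`A_λ⁻ = {h < λ} ∩ A`, `A_λ⁰ = {h = λ} ∩ A`, and `π̃₀ = E_Q[X] − (1+ρ)⁻¹π₀ > 0`, the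
problem of minimizing `E_P[R]` over retentions `R ∈ 𝓘` subject to `E_Q[R] ≥ π̃₀` admits
an optimal solution `R*` supported on `A`, with the two cases of Proposition 4.3, and
`Y* = (X−R*)·1_A + X·1_{S∖A}` is the corresponding optimal indemnity. -/
theorem optimal_retention_linear_utilities {S : Type*} [MeasurableSpace S]
    (M : ℝ) (hM : 0 < M)
    (X : S → ℝ) (hXm : Measurable X) (hX : ∀ s, X s ∈ Set.Icc (0:ℝ) M)
    (Q P Pac Ps : Measure S) [IsProbabilityMeasure Q] [IsProbabilityMeasure P]
    (hdec : P = Pac + Ps) (hac : Pac ≪ Q)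
    (A : Set S) (hAm : MeasurableSet A) (hQA : Q Aᶜ = 0) (hPsA : Ps A = 0)
    (h : S → ℝ) (hhm : Measurable h) (hh0 : ∀ s, 0 ≤ h s)
    (hhd : Pac = Q.withDensity fun s => ENNReal.ofReal (h s))
    (π₀ ρ : ℝ) (hπ : 0 < π₀) (hρ : 0 ≤ ρ)
    (πt : ℝ) (hπt : πt = (∫ s, X s ∂Q) - π₀ / (1 + ρ)) (hπtpos : 0 < πt) :
    ∃ Rstar : S → ℝ,
      -- feasibility of `R*`
      Measurable Rstar ∧ (∀ s, 0 ≤ Rstar s ∧ Rstar s ≤ X s) ∧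
      πt ≤ (∫ s, Rstar s ∂Q) ∧
      -- `R*` is supported on `A`
      (∀ s ∉ A, Rstar s = 0) ∧
      -- optimality: `R*` minimizes `E_P[R]` over feasible retentions
      (∀ R : S → ℝ, Measurable R → (∀ s, 0 ≤ R s ∧ R s ≤ X s) →
        πt ≤ (∫ s, R s ∂Q) → (∫ s, Rstar s ∂P) ≤ ∫ s, R s ∂P) ∧
      -- the corresponding optimal indemnity has the stated form
      ((fun s => X s - Rstar s)
        = fun s => A.indicator (fun t => X t - Rstar t) s + Aᶜ.indicator X s) ∧
      -- Case 1
      ((∫ s in {t | t ∈ A ∧ h t = 0}, X s ∂Q) < πt →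
        ∃ lam : ℝ, 0 < lam ∧
          Rstar = (fun s => ({t | t ∈ A ∧ h t < lam}).indicator X s
            + (if (∫ s in {t | t ∈ A ∧ h t < lam}, X s ∂Q) = πt then (0:ℝ)
               else (πt - ∫ s in {t | t ∈ A ∧ h t < lam}, X s ∂Q)
                 / (∫ s in {t | t ∈ A ∧ h t = lam}, X s ∂Q))
              * ({t | t ∈ A ∧ h t = lam}).indicator X s) ∧
          (∫ s, Rstar s ∂Q) = πt ∧
          ((∫ s in {t | t ∈ A ∧ h t < lam}, X s ∂Q) ≠ πt →
            (πt - ∫ s in {t | t ∈ A ∧ h t < lam}, X s ∂Q)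
              / (∫ s in {t | t ∈ A ∧ h t = lam}, X s ∂Q) ∈ Set.Ioc (0:ℝ) 1)) ∧
      -- Case 2
      (πt ≤ (∫ s in {t | t ∈ A ∧ h t = 0}, X s ∂Q) →
        Rstar = (fun s => (πt / ∫ s in {t | t ∈ A ∧ h t = 0}, X s ∂Q)
            * ({t | t ∈ A ∧ h t = 0}).indicator X s) ∧
        πt / (∫ s in {t | t ∈ A ∧ h t = 0}, X s ∂Q) ∈ Set.Ioc (0:ℝ) 1) := by
  have hX0 : ∀ s, 0 ≤ X s := fun s => (hX s).1
  have hXM : ∀ s, X s ≤ M := fun s => (hX s).2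
  have hXi : Integrable X Q := Integrable.of_bound hXm.aestronglyMeasurable M <|
    Filter.Eventually.of_forall fun s => by
      rw [Real.norm_of_nonneg (hX0 s)]
      exact hXM s
  have hindem : ∀ R₀ : S → ℝ, (∀ s ∉ A, R₀ s = 0) → (fun s => X s - R₀ s)
      = fun s => A.indicator (fun t => X t - R₀ t) s + Aᶜ.indicator X s := fun R₀ hR₀ => by
    funext s
    by_cases hs : s ∈ A
    · simp [hs]
    · simp [hs, hR₀ s hs]
  have hmeq : ∀ l : ℝ, MeasurableSet {t | t ∈ A ∧ h t = l} := fun l =>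
    hAm.inter (measurableSet_eq_fun hhm measurable_const)
  have hmlt : ∀ l : ℝ, MeasurableSet {t | t ∈ A ∧ h t < l} := fun l =>
    hAm.inter (measurableSet_lt hhm measurable_const)
  rcases lt_or_ge (∫ s in {t | t ∈ A ∧ h t = 0}, X s ∂Q) πt with hcase | hcase
  · have hzero : {t | t ∈ A ∧ h t ≤ 0} = {t | t ∈ A ∧ h t = 0} := by
      ext t
      exact and_congr_right fun _ => ⟨fun ht => le_antisymm ht (hh0 t), fun ht => ht.le⟩
    have hhigh : πt < ∫ s in A, X s ∂Q := by
      have hAX : ∫ s in A, X s ∂Q = ∫ s, X s ∂Q := by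
        rw [← integral_add_compl hAm hXi, setIntegral_measure_zero X hQA, add_zero]
      have : 0 < π₀ / (1 + ρ) := by positivity
      linarith
    obtain ⟨lam, hlam, hG, hF⟩ := exists_level_setIntegral hXi hX0 hhm hAm
      (hzero ▸ hcase) hhigh
    have hunion : {t | t ∈ A ∧ h t ≤ lam}
        = {t | t ∈ A ∧ h t < lam} ∪ {t | t ∈ A ∧ h t = lam} := by
      ext t
      simp only [Set.mem_union, Set.mem_ofPred_eq, le_iff_lt_or_eq, and_or_left]
    have hdisj : Disjoint {t | t ∈ A ∧ h t < lam} {t | t ∈ A ∧ h t = lam} :=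
      Set.disjoint_left.mpr fun t h1 h2 => h1.2.ne h2.2
    rw [hunion, setIntegral_union hdisj (hmeq lam) hXi.integrableOn hXi.integrableOn] at hF
    set G := ∫ s in {t | t ∈ A ∧ h t < lam}, X s ∂Q
    set E := ∫ s in {t | t ∈ A ∧ h t = lam}, X s ∂Q
    have hfrac : G ≠ πt → 0 < E ∧ (πt - G) / E ∈ Set.Ioc (0 : ℝ) 1 := fun hne => by
      have hlt : G < πt := lt_of_le_of_ne hG hne
      have hE : 0 < E := by linarith
      exact ⟨hE, div_pos (by linarith) hE, (div_le_one hE).mpr (by linarith)⟩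
    obtain ⟨c, hc⟩ : ∃ c : ℝ, c = if G = πt then (0 : ℝ) else (πt - G) / E := ⟨_, rfl⟩
    have hcprop : 0 ≤ c ∧ c ≤ 1 ∧ G + c * E = πt := by
      by_cases hGe : G = πt
      · rw [if_pos hGe] at hc
        simp [hc, hGe]
      · rw [if_neg hGe] at hc
        obtain ⟨hE, hI⟩ := hfrac hGe
        refine ⟨hc ▸ hI.1.le, hc ▸ hI.2, ?_⟩
        rw [hc, div_mul_cancel₀ _ hE.ne']
        ring
    obtain ⟨hc0, hc1, hcE⟩ := hcprop
    set R₀ : S → ℝ := fun s => ({t | t ∈ A ∧ h t < lam}).indicator X s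
      + c * ({t | t ∈ A ∧ h t = lam}).indicator X s with hR₀def
    have hR₀m : Measurable R₀ :=
      (hXm.indicator (hmlt lam)).add ((hXm.indicator (hmeq lam)).const_mul c)
    have hval_lt : ∀ s ∈ A, h s < lam → R₀ s = X s := fun s hs hl => by
      simp [hR₀def, hs, hl, hl.ne]
    have hval_eq : ∀ s ∈ A, h s = lam → R₀ s = c * X s := fun s hs hl => by
      simp [hR₀def, hs, hl]
    have hval_gt : ∀ s ∈ A, lam < h s → R₀ s = 0 := fun s hs hl => by
      simp [hR₀def, hl.not_gt, hl.ne']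
    have hval_out : ∀ s ∉ A, R₀ s = 0 := fun s hs => by simp [hR₀def, hs]
    have hR₀ : ∀ s, 0 ≤ R₀ s ∧ R₀ s ≤ X s := fun s => by
      by_cases hs : s ∈ A
      · rcases lt_trichotomy (h s) lam with hl | hl | hl
        · exact (hval_lt s hs hl).symm ▸ ⟨hX0 s, le_rfl⟩
        · rw [hval_eq s hs hl]
          exact ⟨mul_nonneg hc0 (hX0 s), mul_le_of_le_one_left (hX0 s) hc1⟩
        · exact (hval_gt s hs hl).symm ▸ ⟨le_rfl, hX0 s⟩
      · exact (hval_out s hs).symm ▸ ⟨le_rfl, hX0 s⟩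
    have hR₀int : ∫ s, R₀ s ∂Q = πt := by
      rw [hR₀def, integral_add (hXi.indicator (hmlt lam))
        ((hXi.indicator (hmeq lam)).const_mul c), integral_const_mul,
        integral_indicator (hmlt lam), integral_indicator (hmeq lam)]
      exact hcE
    refine ⟨R₀, hR₀m, hR₀, hR₀int.ge, hval_out, fun R hRm hR hRint => ?_, hindem R₀ hval_out,
      fun _ => ⟨lam, hlam, ?_, hR₀int, fun hne => (hfrac hne).2⟩,
      fun hcontra => absurd hcase hcontra.not_gt⟩
    · exact integral_threshold_le hXM hdec hQA hPsA hhm hh0 hhd hlam.le hR₀m hR₀ hval_out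
        hval_lt hval_gt hRm hR (hR₀int.le.trans hRint)
    · rw [hR₀def, hc]
  · set E := ∫ s in {t | t ∈ A ∧ h t = 0}, X s ∂Q
    have hE : 0 < E := hπtpos.trans_le hcase
    have hc : πt / E ∈ Set.Ioc (0 : ℝ) 1 := ⟨div_pos hπtpos hE, (div_le_one hE).mpr hcase⟩
    set R₀ : S → ℝ := fun s => (πt / E) * ({t | t ∈ A ∧ h t = 0}).indicator X s with hR₀def
    have hR₀m : Measurable R₀ := (hXm.indicator (hmeq 0)).const_mul _
    have hval_out : ∀ s ∉ A, R₀ s = 0 := fun s hs => by simp [hR₀def, hs]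
    have hR₀ : ∀ s, 0 ≤ R₀ s ∧ R₀ s ≤ X s := fun s => by
      have hi0 : 0 ≤ ({t | t ∈ A ∧ h t = 0}).indicator X s :=
        Set.indicator_nonneg (fun t _ => hX0 t) s
      exact ⟨mul_nonneg hc.1.le hi0, (mul_le_of_le_one_left hi0 hc.2).trans
        (Set.indicator_le_self' (fun t _ => hX0 t) s)⟩
    have hR₀int : ∫ s, R₀ s ∂Q = πt := by
      rw [hR₀def, integral_const_mul, integral_indicator (hmeq 0)]
      exact div_mul_cancel₀ _ hE.ne'
    refine ⟨R₀, hR₀m, hR₀, hR₀int.ge, hval_out, fun R hRm hR hRint => ?_, hindem R₀ hval_out,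
      fun hcontra => absurd hcase hcontra.not_ge, fun _ => ⟨rfl, hc⟩⟩
    exact integral_threshold_le hXM hdec hQA hPsA hhm hh0 hhd le_rfl hR₀m hR₀ hval_out
      (fun s _ hl => absurd hl (hh0 s).not_gt) (fun s _ hl => by simp [hR₀def, hl.ne'])
      hRm hR (hR₀int.le.trans hRint)
end

section
/- In the setting of Proposition 4.2 (risk-neutral insurer, no-sabotage feasible set 𝓘̂), suppose additionally that the worst-case prior P is absolutely continuous with respect to Q with dP/dQ = ξ∘X for a nonnegative, nondecreasing Borel function ξ, that Q∘X⁻¹ has a continuous cumulative distribution function on [0,M], and that u is strictly increasing, concave and continuously differentiable. Then the optimal indemnity in 𝓘̂ is a deductible contract: there exists d* ∈ [0,M] such that Î*(x) = max(x − d*, 0) for all x ∈ [0,M] is optimal, where the boundary values d* = 0 and d* = M correspond to full insurance and no insurance, respectively. -/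
open MeasureTheory

/-- The tangent line of a concave function lies above its graph. -/
lemma ConcaveOn.le_add_mul_of_hasDerivAt {f : ℝ → ℝ} (hf : ConcaveOn ℝ Set.univ f)
    {x f' : ℝ} (hx : HasDerivAt f f' x) (y : ℝ) : f y ≤ f x + f' * (y - x) := by
  rcases lt_trichotomy x y with h | rfl | h
  · have hs := hf.slope_le_of_hasDerivAt (Set.mem_univ x) (Set.mem_univ y) h hx
    rw [slope_def_field, div_le_iff₀ (sub_pos.2 h)] at hs
    linarith
  · simp
  · have hs := hf.le_slope_of_hasDerivAt (Set.mem_univ y) (Set.mem_univ x) h hx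
    rw [slope_def_field, le_div_iff₀ (sub_pos.2 h)] at hs
    linarith

/-- The derivative of a differentiable concave function is antitone. -/
lemma ConcaveOn.antitone_of_hasDerivAt {f f' : ℝ → ℝ} (hf : ConcaveOn ℝ Set.univ f)
    (hd : ∀ x, HasDerivAt f (f' x) x) : Antitone f' := by
  intro x y hxy
  rcases hxy.eq_or_lt with rfl | hlt
  · rfl
  · have hx := hf.le_add_mul_of_hasDerivAt (hd x) y
    have hy := hf.le_add_mul_of_hasDerivAt (hd y) x
    by_contra! hc
    nlinarith

/-- If `h` changes sign at most once, from nonnegative to negative, then a nonnegative monotone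
weight `g` can be replaced by a constant in an upper bound for `g * h`. -/
lemma exists_const_mul_le_of_single_crossing {a b : ℝ} (hab : a ≤ b) {g h : ℝ → ℝ}
    (hg : MonotoneOn g (Set.Icc a b)) (hg0 : ∀ x ∈ Set.Icc a b, 0 ≤ g x) (ha : 0 ≤ h a)
    (hh : ∀ x ∈ Set.Icc a b, ∀ y ∈ Set.Icc a b, x ≤ y → h x < 0 → h y < 0) :
    ∃ c, 0 ≤ c ∧ ∀ x ∈ Set.Icc a b, g x * h x ≤ c * h x := by
  set A := g '' {x ∈ Set.Icc a b | 0 ≤ h x} with hA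
  have haI : a ∈ Set.Icc a b := Set.left_mem_Icc.2 hab
  have hmem : ∀ x ∈ Set.Icc a b, 0 ≤ h x → g x ∈ A := fun x hx hx0 => ⟨x, ⟨hx, hx0⟩, rfl⟩
  have hbdd : BddAbove A := by
    refine ⟨g b, ?_⟩
    rintro _ ⟨x, ⟨hx, -⟩, rfl⟩
    exact hg hx (Set.right_mem_Icc.2 hab) hx.2
  refine ⟨sSup A, (hg0 a haI).trans (le_csSup hbdd (hmem a haI ha)), fun x hx => ?_⟩
  rcases le_or_gt 0 (h x) with hx0 | hx0
  · exact mul_le_mul_of_nonneg_right (le_csSup hbdd (hmem x hx hx0)) hx0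
  · refine mul_le_mul_of_nonpos_right (csSup_le ⟨_, hmem a haI ha⟩ ?_) hx0.le
    rintro _ ⟨y, ⟨hy, hy0⟩, rfl⟩
    refine hg hy hx ?_
    by_contra! hxy
    exact absurd (hh x hx y hy hxy.le hx0) hy0.not_gt

/-- The expected payment of a deductible contract depends continuously on the deductible, so every
level between no insurance and full insurance is attained. -/
lemma exists_deductible_integral_eq {S : Type*} [MeasurableSpace S] {Q : Measure S}
    [IsFiniteMeasure Q] {M : ℝ} (hM : 0 ≤ M) {X : S → ℝ} (hXm : Measurable X)
    (hX : ∀ s, X s ∈ Set.Icc (0 : ℝ) M) {p : ℝ} (hp0 : 0 ≤ p) (hp : p ≤ ∫ s, X s ∂Q) :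
    ∃ d ∈ Set.Icc (0 : ℝ) M, ∫ s, max (X s - d) 0 ∂Q = p := by
  have hcont : ContinuousOn (fun d : ℝ => ∫ s, max (X s - d) 0 ∂Q) (Set.Icc 0 M) := by
    refine continuousOn_of_dominated (bound := fun _ => M)
      (fun d _ => by fun_prop) (fun d hd => ?_) (integrable_const _)
      (Filter.Eventually.of_forall fun s => by fun_prop)
    refine Filter.Eventually.of_forall fun s => ?_
    rw [Real.norm_of_nonneg (le_max_right _ _)]
    exact max_le (by linarith [(hX s).2, hd.1]) hM
  refine intermediate_value_Icc' hM hcont ⟨?_, ?_⟩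
  · have h0 : ∀ s, max (X s - M) 0 = 0 := fun s => max_eq_right (by linarith [(hX s).2])
    simpa [h0] using hp0
  · have h0 : ∀ s, max (X s - 0) 0 = X s := fun s => by
      rw [sub_zero]
      exact max_eq_left (hX s).1
    simpa only [h0] using hp

/-- A function that is monotone on an interval becomes measurable when composed with a measurable
map into that interval. -/
lemma MonotoneOn.measurable_comp_of_mem_Icc {S : Type*} [MeasurableSpace S] {a b : ℝ}
    {f : ℝ → ℝ} (hf : MonotoneOn f (Set.Icc a b)) {X : S → ℝ} (hXm : Measurable X)
    (hX : ∀ s, X s ∈ Set.Icc a b) : Measurable fun s => f (X s) := by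
  rcases isEmpty_or_nonempty S with hS | ⟨⟨s₀⟩⟩
  · exact measurable_of_empty _
  have hab : a ≤ b := (hX s₀).1.trans (hX s₀).2
  have hmono : Monotone (Set.IccExtend hab fun x : Set.Icc a b => f x) :=
    Monotone.IccExtend hab fun x y hxy => hf x.2 y.2 hxy
  have heq : (fun s => f (X s)) = fun s => Set.IccExtend hab (fun x : Set.Icc a b => f x) (X s) :=
    funext fun s => (Set.IccExtend_of_mem hab (fun x : Set.Icc a b => f x) (hX s)).symm
  rw [heq]
  exact hmono.measurable.comp hXm

/-- Example 4.3 (risk-neutral insurer, no-sabotage feasible set, weighted-density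
worst-case prior): if the worst-case prior `P` is absolutely continuous w.r.t. `Q` with
nondecreasing density `dP/dQ = ξ ∘ X`, the law `Q ∘ X⁻¹` has a continuous cdf on
`[0, M]`, and `u` is strictly increasing, concave and `C¹`, then a deductible contract
is optimal in `𝓘̂`: there is `d* ∈ [0,M]` such that `Î*(x) = max (x − d*) 0` is
feasible and maximizes `E_P[u(W₀ − X + Î(X) − π₀)]` over all no-sabotage indemnities
satisfying the budget constraint `(1+ρ)E_Q[Î(X)] ≤ π₀`. -/
theorem deductible_optimal_weighted_prior {S : Type*} [MeasurableSpace S]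
    (M : ℝ) (hM : 0 < M)
    (X : S → ℝ) (hXm : Measurable X) (hX : ∀ s, X s ∈ Set.Icc (0:ℝ) M)
    (Q P : Measure S) [IsProbabilityMeasure Q] [IsProbabilityMeasure P]
    (ξ : ℝ → ℝ) (hξm : Measurable ξ) (hξ0 : ∀ x, 0 ≤ ξ x)
    (hξmono : MonotoneOn ξ (Set.Ici (0:ℝ)))
    (hP : P = Q.withDensity fun s => ENNReal.ofReal (ξ (X s)))
    (hcdf : Continuous fun t : ℝ => ((Q.map X) (Set.Iic t)).toReal)
    (W₀ π₀ ρ : ℝ) (hπ : 0 < π₀) (hρ : 0 ≤ ρ)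
    (hbudget : π₀ < (1 + ρ) * ∫ s, X s ∂Q)
    (u u' : ℝ → ℝ)
    (hu : StrictMono u) (hucc : ConcaveOn ℝ Set.univ u)
    (hud : ∀ x, HasDerivAt u (u' x) x) (hu'c : Continuous u') :
    ∃ d ∈ Set.Icc (0:ℝ) M,
      (1 + ρ) * (∫ s, max (X s - d) 0 ∂Q) ≤ π₀ ∧
      ∀ I : ℝ → ℝ, I 0 = 0 →
        (∀ x₁ x₂ : ℝ, 0 ≤ x₂ → x₂ ≤ x₁ → x₁ ≤ M →
          0 ≤ I x₁ - I x₂ ∧ I x₁ - I x₂ ≤ x₁ - x₂) →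
        (1 + ρ) * (∫ s, I (X s) ∂Q) ≤ π₀ →
        (∫ s, u (W₀ - X s + I (X s) - π₀) ∂P)
          ≤ ∫ s, u (W₀ - X s + max (X s - d) 0 - π₀) ∂P := by
  have hρ1 : (0 : ℝ) < 1 + ρ := by linarith
  obtain ⟨d, hd, hdQ⟩ := exists_deductible_integral_eq (Q := Q) hM.le hXm hX
    (p := π₀ / (1 + ρ)) (by positivity) ((div_le_iff₀' hρ1).2 hbudget.le)
  have hdQ' : (1 + ρ) * ∫ s, max (X s - d) 0 ∂Q = π₀ := by
    rw [hdQ, mul_div_cancel₀ _ hρ1.ne']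
  refine ⟨d, hd, hdQ'.le, fun I hI0 hI hIQ => ?_⟩
  have hIle : ∀ x ∈ Set.Icc (0 : ℝ) M, 0 ≤ I x ∧ I x ≤ x := fun x hx => by
    simpa [hI0] using hI x 0 le_rfl hx.1 hx.2
  have hImono : MonotoneOn I (Set.Icc 0 M) := fun x hx y hy hxy => by
    linarith [(hI y x hx.1 hxy hy.2).1]
  have hIm : Measurable fun s => I (X s) := hImono.measurable_comp_of_mem_Icc hXm hX
  have hJm : Measurable fun s => max (X s - d) 0 := by fun_prop
  have hJle : ∀ s, 0 ≤ max (X s - d) 0 ∧ max (X s - d) 0 ≤ X s := fun s =>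
    ⟨le_max_right _ _, max_le (by linarith [hd.1]) (hX s).1⟩
  have hint : ∀ Y : S → ℝ, Measurable Y → (∀ s, 0 ≤ Y s ∧ Y s ≤ X s) → Integrable Y Q :=
    fun Y hYm hY => Integrable.of_bound hYm.aestronglyMeasurable M <|
      Filter.Eventually.of_forall fun s => by
        rw [Real.norm_of_nonneg (hY s).1]
        exact (hY s).2.trans (hX s).2
  have hξle : ∀ s, ξ (X s) ≤ ξ M := fun s => hξmono (hX s).1 hM.le (hX s).2
  have huint : ∀ Y : S → ℝ, Measurable Y → (∀ s, 0 ≤ Y s ∧ Y s ≤ X s) →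
      Integrable (fun s => ξ (X s) * u (W₀ - X s + Y s - π₀)) Q := by
    intro Y hYm hY
    refine Integrable.of_bound ((hξm.comp hXm).mul (hu.monotone.measurable.comp
      (by fun_prop))).aestronglyMeasurable
      (ξ M * max |u (W₀ - M - π₀)| |u (W₀ - π₀)|) (Filter.Eventually.of_forall fun s => ?_)
    rw [norm_mul, Real.norm_of_nonneg (hξ0 _), Real.norm_eq_abs]
    refine mul_le_mul (hξle s) (abs_le_max_abs_abs (hu.monotone ?_) (hu.monotone ?_))
      (abs_nonneg _) (hξ0 _)
    · linarith [(hX s).2, (hY s).1]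
    · linarith [(hY s).2]
  have hanti := hucc.antitone_of_hasDerivAt hud
  have hu'0 : ∀ x, 0 ≤ u' x := fun x => by
    have h1 := hucc.le_add_mul_of_hasDerivAt (hud x) (x + 1)
    have h2 := hu (lt_add_one x)
    linarith
  obtain ⟨c, hc0, hc⟩ := exists_const_mul_le_of_single_crossing hM.le
    (g := fun x => ξ x * u' (W₀ - x + max (x - d) 0 - π₀))
    (h := fun x => I x - max (x - d) 0)
    (fun x hx y hy hxy => mul_le_mul (hξmono hx.1 hy.1 hxy)
      (hanti (by
        rcases max_cases (x - d) 0 with h1 | h1 <;> rcases max_cases (y - d) 0 with h2 | h2 <;>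
          linarith))
      (hu'0 _) (hξ0 _))
    (fun x _ => mul_nonneg (hξ0 _) (hu'0 _))
    (by simp [hI0, hd.1])
    (fun x hx y hy hxy h => by
      have h1 := (hIle x hx).1
      have h2 := (hI y x hx.1 hxy hy.2).2
      rcases max_cases (x - d) 0 with h3 | h3 <;> rcases max_cases (y - d) 0 with h4 | h4 <;>
        linarith)
  have hpt : ∀ s, ξ (X s) * u (W₀ - X s + I (X s) - π₀) ≤
      ξ (X s) * u (W₀ - X s + max (X s - d) 0 - π₀) + c * (I (X s) - max (X s - d) 0) := by
    intro s
    have h1 := mul_le_mul_of_nonneg_left (hucc.le_add_mul_of_hasDerivAt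
      (hud (W₀ - X s + max (X s - d) 0 - π₀)) (W₀ - X s + I (X s) - π₀)) (hξ0 (X s))
    have h2 := hc (X s) (hX s)
    linarith
  have hdens : ∀ f : S → ℝ, ∫ s, f s ∂P = ∫ s, ξ (X s) * f s ∂Q := fun f => by
    rw [hP, integral_withDensity_eq_integral_toReal_smul
      (f := fun s => ENNReal.ofReal (ξ (X s))) (hξm.comp hXm).ennreal_ofReal
      (Filter.Eventually.of_forall fun _ => ENNReal.ofReal_lt_top)]
    simp only [ENNReal.toReal_ofReal (hξ0 _), smul_eq_mul]
  have hIint := hint _ hIm fun s => hIle _ (hX s)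
  have hJint := hint _ hJm hJle
  have hdiff : ∫ s, I (X s) ∂Q ≤ ∫ s, max (X s - d) 0 ∂Q :=
    le_of_mul_le_mul_left (hIQ.trans hdQ'.ge) hρ1
  have hint_le := integral_mono (huint _ hIm fun s => hIle _ (hX s))
    ((huint _ hJm hJle).add ((hIint.sub hJint).const_mul c)) hpt
  rw [integral_add' (huint _ hJm hJle) ((hIint.sub hJint).const_mul c), integral_const_mul,
    integral_sub' hIint hJint] at hint_le
  rw [hdens, hdens]
  linarith [mul_nonpos_of_nonneg_of_nonpos hc0 (sub_nonpos.2 hdiff)]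
end

section
/- Let K and C be compact topological spaces and u : K × C → ℝ jointly continuous. Let P⁽⁰⁾ ∈ C be arbitrary, and suppose sequences (Ŷ⁽ᵐ⁾)_{m≥1} in K and (P⁽ᵐ⁾)_{m≥1} in C satisfy the successive convex programming iteration: Ŷ⁽ᵐ⁺¹⁾ ∈ argmax_{Ŷ∈K} min_{0≤i≤m} u(Ŷ, P⁽ⁱ⁾) and P⁽ᵐ⁺¹⁾ ∈ argmin_{P∈C} u(Ŷ⁽ᵐ⁺¹⁾, P), for all m ≥ 0. Then the values u⁽ᵐ⁾ := min_{0≤i≤m} u(Ŷ⁽ᵐ⁺¹⁾, P⁽ⁱ⁾) form a nonincreasing sequence converging to some u* > −∞, and every cluster point Ŷ* of the sequence (Ŷ⁽ᵐ⁾) satisfies min_{P∈C} u(Ŷ*, P) = u* and Ŷ* ∈ argmax_{Ŷ∈K} min_{P∈C} u(Ŷ, P); that is, every cluster point of the iteration solves the maximin problem. -/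
open Filter Topology

/-- A jointly continuous function is continuous in the first variable uniformly over a compact
second factor. -/
theorem eventually_forall_abs_sub_lt_of_continuous {K C : Type*} [TopologicalSpace K]
    [TopologicalSpace C] [CompactSpace C] {u : K → C → ℝ}
    (hu : Continuous fun p : K × C => u p.1 p.2) (y₀ : K) {ε : ℝ} (hε : 0 < ε) :
    ∀ᶠ y in 𝓝 y₀, ∀ p : C, |u y p - u y₀ p| < ε := by
  have h := isCompact_univ.eventually_forall_of_forall_eventually (x₀ := y₀) (K := Set.univ)
    (P := fun y (p : C) => |u y p - u y₀ p| < ε) fun p _ => by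
      have hg : Continuous fun z : K × C => |u z.1 z.2 - u y₀ z.2| :=
        (hu.sub (hu.comp (continuous_const.prodMk continuous_snd))).abs
      exact hg.continuousAt.eventually_lt continuousAt_const (by simpa using hε)
  simpa using h

/-- Proposition D.1: convergence of the successive convex programming algorithm.
Let `K` and `C` be compact (nonempty) topological spaces and `u : K × C → ℝ` jointly
continuous.  If the sequences `(Y⁽ᵐ⁾)` in `K` and `(P⁽ᵐ⁾)` in `C` satisfy the SCP
iteration — `Y⁽ᵐ⁺¹⁾` maximizes `Ŷ ↦ min_{0≤i≤m} u(Ŷ, P⁽ⁱ⁾)` over `K` and `P⁽ᵐ⁺¹⁾`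
minimizes `P ↦ u(Y⁽ᵐ⁺¹⁾, P)` over `C` — then the values
`u⁽ᵐ⁾ = min_{0≤i≤m} u(Y⁽ᵐ⁺¹⁾, P⁽ⁱ⁾)` form a nonincreasing sequence converging to a
(finite) limit `u*`, and every cluster point `Y*` of `(Y⁽ᵐ⁾)` satisfies
`min_{P∈C} u(Y*, P) = u*` and solves the maximin problem
`max_{Y∈K} min_{P∈C} u(Y, P)`. -/
theorem scp_cluster_point_solves_maximin {K C : Type*}
    [TopologicalSpace K] [CompactSpace K] [Nonempty K]
    [TopologicalSpace C] [CompactSpace C] [Nonempty C]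
    (u : K → C → ℝ) (hu : Continuous fun p : K × C => u p.1 p.2)
    (Y : ℕ → K) (P : ℕ → C)
    (hY : ∀ m : ℕ, ∀ Y' : K,
      (⨅ i : Fin (m + 1), u Y' (P i.val)) ≤ ⨅ i : Fin (m + 1), u (Y (m + 1)) (P i.val))
    (hP : ∀ m : ℕ, ∀ P' : C, u (Y (m + 1)) (P (m + 1)) ≤ u (Y (m + 1)) P') :
    (Antitone fun m : ℕ => ⨅ i : Fin (m + 1), u (Y (m + 1)) (P i.val)) ∧
    ∃ ustar : ℝ,
      Tendsto (fun m : ℕ => ⨅ i : Fin (m + 1), u (Y (m + 1)) (P i.val))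
        atTop (𝓝 ustar) ∧
      ∀ Ystar : K, MapClusterPt Ystar atTop Y →
        (⨅ p : C, u Ystar p) = ustar ∧
        ∀ Y' : K, (⨅ p : C, u Y' p) ≤ ⨅ p : C, u Ystar p := by
  have hbC : ∀ y, BddBelow (Set.range (u y)) := fun y =>
    (isCompact_range (hu.comp (continuous_const.prodMk continuous_id))).bddBelow
  have hbF : ∀ (y : K) (m : ℕ), BddBelow (Set.range fun i : Fin (m + 1) => u y (P i.val)) :=
    fun y m => (Set.finite_range _).bddBelow
  have hanti : Antitone fun m : ℕ => ⨅ i : Fin (m + 1), u (Y (m + 1)) (P i.val) := by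
    refine antitone_nat_of_succ_le fun m => le_trans ?_ (hY m (Y (m + 1 + 1)))
    exact le_ciInf fun i => ciInf_le (hbF _ (m + 1)) i.castSucc
  have hle : ∀ (y : K) (m : ℕ),
      (⨅ p : C, u y p) ≤ ⨅ i : Fin (m + 1), u (Y (m + 1)) (P i.val) := fun y m =>
    (le_ciInf fun i : Fin (m + 1) => ciInf_le (hbC y) (P i.val)).trans (hY m y)
  have hbdd : BddBelow (Set.range fun m : ℕ => ⨅ i : Fin (m + 1), u (Y (m + 1)) (P i.val)) := by
    refine ⟨⨅ p : C, u (Y 0) p, ?_⟩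
    rintro _ ⟨m, rfl⟩
    exact hle _ m
  refine ⟨hanti, _, tendsto_atTop_ciInf hanti hbdd, fun y₀ hy₀ => ?_⟩
  set v := ⨅ m : ℕ, ⨅ i : Fin (m + 1), u (Y (m + 1)) (P i.val)
  have hle_v : ∀ y, (⨅ p : C, u y p) ≤ v := fun y => le_ciInf (hle y)
  have hlow : ∀ m i : ℕ, i ≤ m → v ≤ u (Y (m + 1)) (P i) := fun m i him =>
    (ciInf_le hbdd m).trans (ciInf_le (hbF (Y (m + 1)) m) ⟨i, Nat.lt_succ_of_le him⟩)
  have hclust : ∀ i, v ≤ u y₀ (P i) := by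
    intro i
    refine le_of_forall_pos_le_add fun ε hε => ?_
    obtain ⟨n, hn, hni⟩ :=
      ((hy₀.frequently (eventually_forall_abs_sub_lt_of_continuous hu y₀ hε)).and_eventually
        (eventually_gt_atTop i)).exists
    obtain ⟨m, rfl⟩ : ∃ m, n = m + 1 := ⟨n - 1, by omega⟩
    linarith [hlow m i (by omega), (abs_lt.1 (hn (P i))).2]
  have heq : (⨅ p : C, u y₀ p) = v := by
    refine le_antisymm (hle_v y₀) (le_ciInf fun p => le_of_forall_pos_le_add fun ε hε => ?_)
    obtain ⟨n, hn, hn0⟩ :=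
      ((hy₀.frequently (eventually_forall_abs_sub_lt_of_continuous hu y₀
        (half_pos hε))).and_eventually (eventually_gt_atTop 0)).exists
    obtain ⟨m, rfl⟩ : ∃ m, n = m + 1 := ⟨n - 1, by omega⟩
    linarith [hclust (m + 1), (abs_lt.1 (hn (P (m + 1)))).1, hP m p, (abs_lt.1 (hn p)).2]
  exact ⟨heq, fun y => (hle_v y).trans heq.ge⟩
end
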